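/- arXiv:1802.08539 — 4 statements merged into one kernel-verified Lean document; each statement's English description precedes it below -/
import Mathlib

section
/- Let X be a Polish space, μ0 a Borel probability measure on X, and H a linear subspace of C_b(X) containing the constant functions. Define the superhedging functional φ(f) = inf{∫ h dμ0 : h ∈ H, h ≥ f} for f ∈ C_b(X), and assume φ is continuous from above, i.e. φ(f_n) ↓ 0 for every sequence (f_n) in C_b(X) with f_n ↓ 0 pointwise. Then the set Q = {μ Borel probability on X : ∫ h dμ = ∫ h dμ0 for all h ∈ H} is nonempty (in particular μ0 ∈ Q), and for every f ∈ C_b(X) one has φ(f) = max_{μ ∈ Q} ∫ f dμ, the maximum being attained. -/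
open MeasureTheory BoundedContinuousFunction Filter Topology

/-- The superhedging functional `φ(f) = inf {∫ h dμ0 : h ∈ H, h ≥ f}`. -/
noncomputable def phi {X : Type*} [TopologicalSpace X] [MeasurableSpace X]
    (μ0 : Measure X) (H : Set (X →ᵇ ℝ)) (f : X →ᵇ ℝ) : ℝ :=
  sInf {r : ℝ | ∃ h ∈ H, (∀ x, f x ≤ h x) ∧ r = ∫ x, h x ∂μ0}

/-- `μ ∈ Q` iff `μ` is a Borel probability measure with `∫ h dμ = ∫ h dμ0` for all `h ∈ H`. -/
def memQ {X : Type*} [TopologicalSpace X] [MeasurableSpace X]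
    (μ0 : Measure X) (H : Set (X →ᵇ ℝ)) (μ : Measure X) : Prop :=
  IsProbabilityMeasure μ ∧ ∀ h ∈ H, ∫ x, h x ∂μ = ∫ x, h x ∂μ0

/-- A linear functional on bounded continuous functions which is positive and continuous along
sequences decreasing pointwise to zero. -/
structure IsDaniell {X : Type*} [TopologicalSpace X] (L : (X →ᵇ ℝ) →ₗ[ℝ] ℝ) : Prop where
  nonneg : ∀ f : X →ᵇ ℝ, (∀ x, 0 ≤ f x) → 0 ≤ L f
  tendsto_zero : ∀ fn : ℕ → X →ᵇ ℝ, (∀ x, Antitone (fun n => fn n x)) →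
    (∀ x, Tendsto (fun n => fn n x) atTop (𝓝 (0 : ℝ))) →
    Tendsto (fun n => L (fn n)) atTop (𝓝 (0 : ℝ))

namespace IsDaniell

variable {X : Type*} [TopologicalSpace X] {L : (X →ᵇ ℝ) →ₗ[ℝ] ℝ}

open scoped CompactlySupported in
/-- The pushforward of a positive functional to a compact space is represented by a regular
measure. -/
theorem exists_regular_measure_of_compactSpace (hL : IsDaniell L) {K : Type*} [TopologicalSpace K]
    [T2Space K] [CompactSpace K] [MeasurableSpace K] [BorelSpace K] (e : C(X, K)) :
    ∃ ν : Measure K, ν.Regular ∧ IsFiniteMeasure ν ∧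
      ∀ g : K →ᵇ ℝ, ∫ y, g y ∂ν = L (g.compContinuous e) := by
  let pullback (g : C_c(K, ℝ)) : X →ᵇ ℝ :=
    (BoundedContinuousFunction.mkOfCompact g.toContinuousMap).compContinuous e
  let Λ₀ : C_c(K, ℝ) →ₗ[ℝ] ℝ :=
    { toFun := fun g => L (pullback g)
      map_add' := fun f g => by
        rw [← map_add]
        rfl
      map_smul' := fun c g => by
        rw [RingHom.id_apply, ← map_smul]
        rfl }
  let Λ : C_c(K, ℝ) →ₚ[ℝ] ℝ :=
    PositiveLinearMap.mk₀ Λ₀ fun g hg => hL.nonneg _ fun x => hg (e x)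
  refine ⟨RealRMK.rieszMeasure Λ, inferInstance, inferInstance, fun g => ?_⟩
  let g' : C_c(K, ℝ) :=
    { toFun := g
      hasCompactSupport' := HasCompactSupport.of_compactSpace _ }
  exact RealRMK.integral_rieszMeasure Λ g'

variable [PolishSpace X] [MeasurableSpace X] [BorelSpace X]

/-- A Daniell functional is represented by a measure on functions factoring through a given
continuous injection into a compact metrizable space. -/
theorem exists_measure_of_injective (hL : IsDaniell L) {K : Type*} [TopologicalSpace K]
    [TopologicalSpace.MetrizableSpace K] [CompactSpace K] [MeasurableSpace K] [BorelSpace K]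
    (e : C(X, K)) (he : Function.Injective e) :
    ∃ μ : Measure X, IsFiniteMeasure μ ∧
      ∀ g : K →ᵇ ℝ, ∫ x, g (e x) ∂μ = L (g.compContinuous e) := by
  let : MetricSpace K := TopologicalSpace.metrizableSpaceMetric K
  have hemb : MeasurableEmbedding e := e.continuous.measurableEmbedding he
  obtain ⟨ν, hreg, hfin, hν⟩ := hL.exists_regular_measure_of_compactSpace e
  have hcompact : ∀ C : Set K, IsCompact C → C ⊆ (Set.range e)ᶜ → ν C = 0 := by
    intro C hC hCe
    have hpos (n : ℕ) : (0 : ℝ) < 1 / ((n : ℝ) + 1) := by positivity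
    have hlim : Tendsto (fun n : ℕ => 1 / ((n : ℝ) + 1)) atTop (𝓝 0) :=
      tendsto_one_div_add_atTop_nhds_zero_nat
    let g (n : ℕ) : K →ᵇ ℝ := BoundedContinuousFunction.mkOfCompact
      ⟨fun y => (thickenedIndicator (hpos n) C y : ℝ), by fun_prop⟩
    have hC0 : Tendsto (fun n => L ((g n).compContinuous e)) atTop (𝓝 0) := by
      refine hL.tendsto_zero _ (fun x m n hmn => ?_) fun x => ?_
      · exact NNReal.coe_le_coe.2 (thickenedIndicator_mono (hpos n) (hpos m)
          (one_div_le_one_div_of_le (by positivity) (by gcongr)) C (e x))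
      · have h := tendsto_pi_nhds.1 (thickenedIndicator_tendsto_indicator_closure hpos hlim C) (e x)
        rw [hC.isClosed.closure_eq, Set.indicator_of_notMem fun hx => hCe hx ⟨x, rfl⟩] at h
        exact NNReal.tendsto_coe.2 h
    have hC1 := tendsto_integral_thickenedIndicator_of_isClosed ν hC.isClosed hpos hlim
    have hreal : ν.real C = 0 :=
      tendsto_nhds_unique hC1 (hC0.congr fun n => (hν (g n)).symm)
    exact (measureReal_eq_zero_iff).1 hreal
  have hrange : ν (Set.range e)ᶜ = 0 := by
    by_contra hne
    obtain ⟨C, hCe, hC, hlt⟩ := hemb.measurableSet_range.compl.exists_lt_isCompact_of_ne_top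
      (measure_ne_top ν _) (pos_iff_ne_zero.2 hne)
    exact hlt.ne' (hcompact C hC hCe)
  have hmap : (ν.comap e).map e = ν := by
    rw [hemb.map_comap]
    exact Measure.restrict_eq_self_of_ae_mem (mem_ae_iff.2 hrange)
  refine ⟨ν.comap e, ⟨?_⟩, fun g => ?_⟩
  · rw [hemb.comap_apply]
    exact measure_lt_top ν _
  · rw [← hemb.integral_map, hmap, hν]

/-- The **Daniell representation theorem** for bounded continuous functions on a Polish space. -/
theorem exists_measure (hL : IsDaniell L) :
    ∃ μ : Measure X, IsFiniteMeasure μ ∧ ∀ f : X →ᵇ ℝ, ∫ x, f x ∂μ = L f := by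
  let : MetricSpace X := TopologicalSpace.metrizableSpaceMetric X
  obtain ⟨F, hF⟩ := Metric.PiNatEmbed.exists_embedding_to_hilbert_cube (X := X)
  let e : C(X, ℕ → unitInterval) := ⟨F, hF.continuous⟩
  have hemb : MeasurableEmbedding e := hF.continuous.measurableEmbedding hF.injective
  obtain ⟨μ, hμfin, hμ⟩ := hL.exists_measure_of_injective e hF.injective
  refine ⟨μ, hμfin, fun f => ?_⟩
  let f' : C(X, Set.Icc (-‖f‖) ‖f‖) :=
    ⟨fun x => ⟨f x, abs_le.1 (f.norm_coe_le_norm x)⟩, by fun_prop⟩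
  obtain ⟨μ', hμ'fin, hμ'⟩ := hL.exists_measure_of_injective (e.prodMk f')
    fun x y hxy => hF.injective (congrArg Prod.fst hxy)
  have hmap : μ.map e = μ'.map e := by
    refine ext_of_forall_integral_eq_of_IsFiniteMeasure fun g => ?_
    rw [hemb.integral_map, hemb.integral_map, hμ]
    exact (hμ' (g.compContinuous ⟨Prod.fst, continuous_fst⟩)).symm
  have heq : μ = μ' := by
    rw [← hemb.comap_map μ, hmap, hemb.comap_map]
  rw [heq]
  exact hμ' (BoundedContinuousFunction.mkOfCompact
    ⟨fun p => (p.2 : ℝ), continuous_subtype_val.comp continuous_snd⟩)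

end IsDaniell

section Superhedging

theorem le_phi {X : Type*} [TopologicalSpace X] [MeasurableSpace X] {μ0 : Measure X}
    {H : Submodule ℝ (X →ᵇ ℝ)} (hconst : ∀ c : ℝ, BoundedContinuousFunction.const X c ∈ H)
    {f : X →ᵇ ℝ} {c : ℝ}
    (hc : ∀ h ∈ H, (∀ x, f x ≤ h x) → c ≤ ∫ x, h x ∂μ0) : c ≤ phi μ0 H f := by
  refine le_csInf ⟨_, _, hconst ‖f‖, fun x => f.apply_le_norm x, rfl⟩ ?_
  rintro _ ⟨h, hh, hfh, rfl⟩
  exact hc h hh hfh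

variable {X : Type*} [TopologicalSpace X] [MeasurableSpace X] [OpensMeasurableSpace X]
  {μ0 : Measure X} [IsProbabilityMeasure μ0]

theorem phi_le {H : Set (X →ᵇ ℝ)} {f h : X →ᵇ ℝ} (hh : h ∈ H) (hfh : ∀ x, f x ≤ h x) :
    phi μ0 H f ≤ ∫ x, h x ∂μ0 := by
  refine csInf_le ⟨-‖f‖, ?_⟩ ⟨h, hh, hfh, rfl⟩
  rintro _ ⟨k, -, hk, rfl⟩
  calc -‖f‖ = ∫ _, -‖f‖ ∂μ0 := by simp
    _ ≤ ∫ x, k x ∂μ0 := integral_mono (integrable_const _) (k.integrable μ0)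
      fun x => (f.neg_norm_le_apply x).trans (hk x)

variable {H : Submodule ℝ (X →ᵇ ℝ)}

theorem phi_zero (hconst : ∀ c : ℝ, BoundedContinuousFunction.const X c ∈ H) :
    phi μ0 H 0 = 0 := by
  refine le_antisymm ?_ (le_phi hconst fun h _ hh => integral_nonneg hh)
  simpa using phi_le (μ0 := μ0) (f := 0) H.zero_mem fun x => le_rfl

theorem phi_add_le (hconst : ∀ c : ℝ, BoundedContinuousFunction.const X c ∈ H) (f g : X →ᵇ ℝ) :
    phi μ0 H (f + g) ≤ phi μ0 H f + phi μ0 H g := by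
  rw [← sub_le_iff_le_add]
  refine le_phi hconst fun h hh hfh => ?_
  rw [sub_le_comm]
  refine le_phi hconst fun k hk hgk => ?_
  rw [sub_le_iff_le_add']
  calc phi μ0 H (f + g) ≤ ∫ x, (h + k) x ∂μ0 :=
        phi_le (H.add_mem hh hk) fun x => add_le_add (hfh x) (hgk x)
    _ = _ := integral_add (h.integrable μ0) (k.integrable μ0)

theorem phi_smul_le (hconst : ∀ c : ℝ, BoundedContinuousFunction.const X c ∈ H) {c : ℝ}
    (hc : 0 < c) (f : X →ᵇ ℝ) : phi μ0 H (c • f) ≤ c * phi μ0 H f := by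
  rw [← div_le_iff₀' hc]
  refine le_phi hconst fun h hh hfh => ?_
  rw [div_le_iff₀' hc, ← integral_const_mul]
  exact phi_le (H.smul_mem c hh) fun x => mul_le_mul_of_nonneg_left (hfh x) hc.le

theorem phi_smul (hconst : ∀ c : ℝ, BoundedContinuousFunction.const X c ∈ H) {c : ℝ}
    (hc : 0 < c) (f : X →ᵇ ℝ) : phi μ0 H (c • f) = c * phi μ0 H f := by
  refine le_antisymm (phi_smul_le hconst hc f) ?_
  have h := phi_smul_le (μ0 := μ0) hconst (inv_pos.2 hc) (c • f)
  rwa [inv_smul_smul₀ hc.ne', ← div_eq_inv_mul, le_div_iff₀' hc] at h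

/-- The superhedging functional dominates a linear functional agreeing with it at a given point. -/
theorem exists_linearMap_le_phi (hconst : ∀ c : ℝ, BoundedContinuousFunction.const X c ∈ H)
    (f : X →ᵇ ℝ) :
    ∃ L : (X →ᵇ ℝ) →ₗ[ℝ] ℝ, L f = phi μ0 H f ∧ ∀ g, L g ≤ phi μ0 H g := by
  have hsing : ∀ c : ℝ, c • f = 0 → RingHom.id ℝ c • phi μ0 H f = 0 := by
    intro c hc
    rcases smul_eq_zero.1 hc with rfl | rfl
    · simp
    · simp [phi_zero hconst]
  have hscale : ∀ c : ℝ, c * phi μ0 H f ≤ phi μ0 H (c • f) := by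
    intro c
    rcases lt_trichotomy c 0 with hc | rfl | hc
    · have h := phi_add_le (μ0 := μ0) hconst (c • f) ((-c) • f)
      rw [← add_smul, add_neg_cancel, zero_smul, phi_zero hconst,
        phi_smul hconst (neg_pos.2 hc)] at h
      linarith
    · simp [phi_zero hconst]
    · exact (phi_smul hconst hc f).ge
  obtain ⟨L, hLf, hL⟩ := exists_extension_of_le_sublinear
    (LinearPMap.mkSpanSingleton' f (phi μ0 H f) hsing) (phi μ0 H)
    (fun c hc g => phi_smul hconst hc g) (phi_add_le hconst) (by
      rintro ⟨g, hg⟩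
      obtain ⟨c, rfl⟩ := Submodule.mem_span_singleton.1 hg
      rw [LinearPMap.mkSpanSingleton'_apply]
      exact hscale c)
  refine ⟨L, ?_, hL⟩
  have hf := Submodule.mem_span_singleton_self (R := ℝ) f
  exact (hLf ⟨f, hf⟩).trans (LinearPMap.mkSpanSingleton'_apply_self f _ hsing hf)

theorem eq_integral_of_le_phi {L : (X →ᵇ ℝ) →ₗ[ℝ] ℝ} (hL : ∀ g, L g ≤ phi μ0 H g) {h : X →ᵇ ℝ}
    (hh : h ∈ H) : L h = ∫ x, h x ∂μ0 := by
  refine le_antisymm ((hL h).trans (phi_le hh fun _ => le_rfl)) ?_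
  have hneg := (hL (-h)).trans (phi_le (H.neg_mem hh) fun _ => le_rfl)
  simp only [map_neg, BoundedContinuousFunction.coe_neg, Pi.neg_apply, integral_neg] at hneg
  exact neg_le_neg_iff.1 hneg

theorem isDaniell_of_le_phi {L : (X →ᵇ ℝ) →ₗ[ℝ] ℝ} (hL : ∀ g, L g ≤ phi μ0 H g)
    (hca : ∀ fn : ℕ → X →ᵇ ℝ, (∀ x, Antitone (fun n => fn n x)) →
      (∀ x, Tendsto (fun n => fn n x) atTop (𝓝 (0 : ℝ))) →
      Tendsto (fun n => phi μ0 (H : Set (X →ᵇ ℝ)) (fn n)) atTop (𝓝 (0 : ℝ))) :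
    IsDaniell L := by
  have hpos : ∀ f : X →ᵇ ℝ, (∀ x, 0 ≤ f x) → 0 ≤ L f := by
    intro f hf
    have h := (hL (-f)).trans (phi_le H.zero_mem fun x => neg_nonpos.2 (hf x))
    simpa using h
  refine ⟨hpos, fun fn hanti hlim => ?_⟩
  exact tendsto_of_tendsto_of_tendsto_of_le_of_le tendsto_const_nhds (hca fn hanti hlim)
    (fun n => hpos _ fun x => (hanti x).le_of_tendsto (hlim x) n) fun n => hL _

end Superhedging

/-- If the superhedging functional `φ` (for a linear subspace `H ⊆ C_b(X)`
containing the constants, over a Polish space) is continuous from above, then `μ0 ∈ Q` and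
`φ(f) = max_{μ ∈ Q} ∫ f dμ`, the maximum being attained. -/
theorem statement0 {X : Type*} [TopologicalSpace X] [PolishSpace X]
    [MeasurableSpace X] [BorelSpace X]
    (μ0 : Measure X) [IsProbabilityMeasure μ0]
    (H : Submodule ℝ (X →ᵇ ℝ))
    (hconst : ∀ c : ℝ, BoundedContinuousFunction.const X c ∈ H)
    (hca : ∀ fn : ℕ → X →ᵇ ℝ, (∀ x, Antitone (fun n => fn n x)) →
      (∀ x, Tendsto (fun n => fn n x) atTop (𝓝 (0 : ℝ))) →
      Tendsto (fun n => phi μ0 (H : Set (X →ᵇ ℝ)) (fn n)) atTop (𝓝 (0 : ℝ))) :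
    memQ μ0 (H : Set (X →ᵇ ℝ)) μ0 ∧
      ∀ f : X →ᵇ ℝ, ∃ μ : Measure X, memQ μ0 (H : Set (X →ᵇ ℝ)) μ ∧
        phi μ0 (H : Set (X →ᵇ ℝ)) f = ∫ x, f x ∂μ ∧
        ∀ ν : Measure X, memQ μ0 (H : Set (X →ᵇ ℝ)) ν → ∫ x, f x ∂ν ≤ ∫ x, f x ∂μ := by
  refine ⟨⟨inferInstance, fun _ _ => rfl⟩, fun f => ?_⟩
  obtain ⟨L, hLf, hL⟩ := exists_linearMap_le_phi (μ0 := μ0) hconst f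
  obtain ⟨μ, hfin, hμ⟩ := (isDaniell_of_le_phi hL hca).exists_measure
  have hμH : ∀ h ∈ H, ∫ x, h x ∂μ = ∫ x, h x ∂μ0 := fun h hh =>
    (hμ h).trans (eq_integral_of_le_phi hL hh)
  have hprob : IsProbabilityMeasure μ := by
    have h := hμH _ (hconst 1)
    simp only [BoundedContinuousFunction.const_apply, integral_const, smul_eq_mul, mul_one,
      probReal_univ] at h
    exact isProbabilityMeasure_iff_real.2 h
  refine ⟨μ, ⟨hprob, hμH⟩, (hLf.symm.trans (hμ f).symm), fun ν hν => ?_⟩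
  have := hν.1
  rw [hμ, hLf]
  refine le_phi hconst fun h hh hfh => ?_
  rw [← hν.2 h hh]
  exact integral_mono (f.integrable ν) (h.integrable ν) hfh
end

section
/- Let X be a Polish space, μ0 a Borel probability measure on X, H a linear subspace of C_b(X) containing the constants with superhedging functional φ continuous from above, and Q = {μ : ∫ h dμ = ∫ h dμ0 for all h ∈ H}. Let β : ℝ → [0,∞) be a differentiable nondecreasing convex function with β(x)/x → ∞ as x → ∞, γ > 0, β_γ(x) = β(γx)/γ, β*(y) = sup_x (xy − β(x)), and θ a Borel probability measure on X. Suppose there exists π ∈ Q with π ≪ θ and ∫ β*(dπ/dθ) dθ < ∞. Then for every f ∈ C_b(X), the regularized functional φ_{θ,γ}(f) = inf_{h ∈ H} { ∫ h dμ0 + ∫ β_γ(f − h) dθ } satisfies φ_{θ,γ}(f) = max_{μ ∈ Q} { ∫ f dμ − (1/γ) ∫ β*(dμ/dθ) dθ }, where the maximum is attained and the term (1/γ)∫β*(dμ/dθ)dθ is interpreted as +∞ when μ is not absolutely continuous with respect to θ. -/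
open MeasureTheory BoundedContinuousFunction Filter Topology

/-- Convex conjugate `β*(y) = sup_{x ∈ ℝ} (x*y - β x)`. -/
noncomputable def betaConj (β : ℝ → ℝ) (y : ℝ) : ℝ :=
  sSup {z : ℝ | ∃ x : ℝ, z = x * y - β x}

/-- The regularized (penalized) superhedging functional
`φ_{θ,γ}(f) = inf_{h ∈ H} { ∫ h dμ0 + ∫ β_γ(f - h) dθ }` with `β_γ(x) = β(γ x)/γ`. -/
noncomputable def phiReg {X : Type*} [TopologicalSpace X] [MeasurableSpace X]
    (μ0 θ : Measure X) (H : Set (X →ᵇ ℝ)) (β : ℝ → ℝ) (γ : ℝ) (f : X →ᵇ ℝ) : ℝ :=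
  sInf {r : ℝ | ∃ h ∈ H, r = (∫ x, h x ∂μ0) + ∫ x, β (γ * (f x - h x)) / γ ∂θ}

/-- The pointed cone `{c • y | 0 ≤ c, y ∈ S}` generated by a nonempty convex set `S`. -/
def Convex.pointedCone {E : Type*} [AddCommGroup E] [Module ℝ E] {S : Set E}
    (hS : Convex ℝ S) (hne : S.Nonempty) : PointedCone ℝ E where
  carrier := {x | ∃ c : ℝ, 0 ≤ c ∧ ∃ y ∈ S, c • y = x}
  add_mem' := by
    rintro _ _ ⟨c, hc, y, hy, rfl⟩ ⟨d, hd, z, hz, rfl⟩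
    rcases (add_nonneg hc hd).eq_or_lt with h | h
    · obtain rfl : c = 0 := by linarith
      obtain rfl : d = 0 := by linarith
      exact ⟨0, le_rfl, y, hy, by simp⟩
    · refine ⟨c + d, h.le, _, convex_iff_div.1 hS hy hz hc hd h, ?_⟩
      rw [smul_add, smul_smul, smul_smul, mul_div_cancel₀ _ h.ne', mul_div_cancel₀ _ h.ne']
  zero_mem' := hne.elim fun y hy => ⟨0, le_rfl, y, hy, by simp⟩
  smul_mem' := by
    rintro a _ ⟨c, hc, y, hy, rfl⟩
    exact ⟨a * c, mul_nonneg a.2 hc, y, hy, mul_smul _ _ _⟩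

/-- Hahn–Banach theorem with a convex majorant: a linear functional `m` dominated by a convex
function `G` along a linear map `ι` factors through a linear functional dominated by `G`. -/
theorem exists_linearMap_le_of_convexOn {E W : Type*} [AddCommGroup E] [Module ℝ E]
    [AddCommGroup W] [Module ℝ W] {G : E → ℝ} (hG : ConvexOn ℝ Set.univ G)
    (ι : W →ₗ[ℝ] E) (m : W →ₗ[ℝ] ℝ) (hm : ∀ w, m w ≤ G (ι w)) :
    ∃ l : E →ₗ[ℝ] ℝ, (∀ w, l (ι w) = m w) ∧ ∀ u, l u ≤ G u := by
  let S : Set (E × ℝ) := {p | ∃ w, G (p.1 - ι w) + m w ≤ p.2}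
  have hS : Convex ℝ S := by
    rintro ⟨v, r⟩ ⟨w, h⟩ ⟨v', r'⟩ ⟨w', h'⟩ a b ha hb hab
    refine ⟨a • w + b • w', ?_⟩
    have key := hG.2 (Set.mem_univ (v - ι w)) (Set.mem_univ (v' - ι w')) ha hb hab
    have e : a • v + b • v' - ι (a • w + b • w') = a • (v - ι w) + b • (v' - ι w') := by
      simp only [map_add, map_smul]; module
    change G (a • v + b • v' - ι (a • w + b • w')) + m (a • w + b • w') ≤ a * r + b * r'
    rw [e, map_add, map_smul, map_smul]
    simp only [smul_eq_mul] at h h' key ⊢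
    nlinarith [mul_le_mul_of_nonneg_left h ha, mul_le_mul_of_nonneg_left h' hb]
  have hmem (v : E) (w : W) : (v, G (v - ι w) + m w) ∈ S := ⟨w, le_rfl⟩
  let F : (E × ℝ) →ₗ.[ℝ] ℝ :=
    ⟨(⊥ : Submodule ℝ E).prod ⊤, (LinearMap.snd ℝ E ℝ).comp (Submodule.subtype _)⟩
  obtain ⟨g, hgF, hg⟩ := riesz_extension (hS.pointedCone ⟨_, hmem 0 0⟩) F
    (by
      rintro ⟨x, hx⟩ ⟨c, hc, ⟨v, r⟩, ⟨w, hw⟩, rfl⟩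
      change 0 ≤ c * r
      have hv : c • v = 0 := hx.1
      rcases hc.eq_or_lt with rfl | hc
      · simp
      · obtain rfl : v = 0 := (smul_eq_zero.1 hv).resolve_left hc.ne'
        have := hm (-w)
        simp only [map_neg, zero_sub] at hw this
        exact mul_nonneg hc.le (by linarith))
    (fun ⟨v, r⟩ => ⟨⟨(0, G (v - ι 0) + m 0 - r), by simp [F]⟩, 1, zero_le_one, _, hmem v 0,
      by simp⟩)
  have hg1 (r : ℝ) : g (0, r) = r := hgF ⟨(0, r), by simp [F]⟩
  let l : E →ₗ[ℝ] ℝ := -(g.comp (LinearMap.inl ℝ E ℝ))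
  have hl (v : E) (w : W) : l v ≤ G (v - ι w) + m w := by
    have h := hg _ ⟨1, zero_le_one, _, hmem v w, one_smul _ _⟩
    have e : (v, G (v - ι w) + m w) = (v, (0 : ℝ)) + ((0 : E), G (v - ι w) + m w) := by simp
    rw [e, map_add, hg1] at h
    change -g (v, 0) ≤ _
    linarith
  refine ⟨l, fun w => ?_, fun u => by simpa using hl u 0⟩
  have ht (t : ℝ) : t * (l (ι w) - m w) ≤ G 0 := by
    have := hl (ι (t • w)) (t • w)
    simp only [sub_self, map_smul, smul_eq_mul] at this
    linarith
  by_contra h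
  have h' : l (ι w) - m w ≠ 0 := sub_ne_zero.2 h
  have := ht ((G 0 + 1) / (l (ι w) - m w))
  rw [div_mul_cancel₀ _ h'] at this
  linarith

theorem hasSum_indicator_iUnion {X : Type*} {f : ℕ → Set X}
    (hd : Pairwise (Function.onFun Disjoint f)) (x : X) :
    HasSum (fun i => (f i).indicator (1 : X → ℝ) x) ((⋃ i, f i).indicator 1 x) := by
  by_cases hx : x ∈ ⋃ i, f i
  · obtain ⟨j, hj⟩ := Set.mem_iUnion.1 hx
    rw [Set.indicator_of_mem hx, ← Set.indicator_of_mem hj (1 : X → ℝ)]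
    exact hasSum_single j fun i hi =>
      Set.indicator_of_notMem (fun h => Set.disjoint_left.1 (hd hi) h hj) _
  · rw [Set.indicator_of_notMem hx]
    convert hasSum_zero with i
    exact Set.indicator_of_notMem (fun h => hx (Set.mem_iUnion_of_mem i h)) _

/-- The space of bounded measurable real-valued functions. -/
def boundedMeasurable (X : Type*) [MeasurableSpace X] : Submodule ℝ (X → ℝ) where
  carrier := {u | Measurable u ∧ ∃ C, ∀ x, |u x| ≤ C}
  add_mem' := by
    rintro u v ⟨hu, C, hC⟩ ⟨hv, D, hD⟩
    exact ⟨hu.add hv, C + D, fun x => (abs_add_le _ _).trans (add_le_add (hC x) (hD x))⟩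
  zero_mem' := ⟨measurable_zero, 0, by simp⟩
  smul_mem' := by
    rintro c u ⟨hu, C, hC⟩
    refine ⟨hu.const_smul c, |c| * C, fun x => ?_⟩
    rw [Pi.smul_apply, smul_eq_mul, abs_mul]
    exact mul_le_mul_of_nonneg_left (hC x) (abs_nonneg c)

namespace boundedMeasurable

variable {X : Type*} [MeasurableSpace X]

theorem measurable (u : boundedMeasurable X) : Measurable (u : X → ℝ) := u.2.1

theorem integrable (u : boundedMeasurable X) (μ : Measure X) [IsFiniteMeasure μ] :
    Integrable (u : X → ℝ) μ := by
  obtain ⟨C, hC⟩ := u.2.2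
  exact Integrable.of_bound (measurable u).aestronglyMeasurable C (ae_of_all _ hC)

/-- The indicator function of a measurable set, as a bounded measurable function. -/
noncomputable def ind (s : Set X) (hs : MeasurableSet s) : boundedMeasurable X :=
  ⟨s.indicator 1, measurable_one.indicator hs, 1, fun x => by
    by_cases hx : x ∈ s <;> simp [hx]⟩

@[simp]
theorem coe_ind (s : Set X) (hs : MeasurableSet s) : (ind s hs : X → ℝ) = s.indicator 1 := rfl

/-- A simple function, as a bounded measurable function. -/
def ofSimpleFunc (s : SimpleFunc X ℝ) : boundedMeasurable X :=
  ⟨s, s.measurable, s.exists_forall_norm_le⟩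

/-- A positive linear functional on the bounded measurable functions which is continuous under
bounded pointwise convergence is the integral against a finite measure. -/
theorem exists_measure_integral_eq (l : boundedMeasurable X →ₗ[ℝ] ℝ)
    (hpos : ∀ u : boundedMeasurable X, (∀ x, 0 ≤ (u : X → ℝ) x) → 0 ≤ l u)
    (hcont : ∀ (u : ℕ → boundedMeasurable X) (C : ℝ), (∀ n x, |(u n : X → ℝ) x| ≤ C) →
      (∀ x, Tendsto (fun n => (u n : X → ℝ) x) atTop (𝓝 0)) →
      Tendsto (fun n => l (u n)) atTop (𝓝 0)) :
    ∃ μ : Measure X, IsFiniteMeasure μ ∧ ∀ u : boundedMeasurable X, ∫ x, (u : X → ℝ) x ∂μ = l u := by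
  have hind (s : Set X) (hs : MeasurableSet s) : 0 ≤ l (ind s hs) :=
    hpos _ fun x => Set.indicator_nonneg (fun _ _ => zero_le_one) x
  have h0 : l (ind ∅ MeasurableSet.empty) = 0 := by
    have : ind (∅ : Set X) MeasurableSet.empty = 0 := Subtype.ext (Set.indicator_empty 1)
    rw [this, map_zero]
  have hU (f : ℕ → Set X) (h : ∀ i, MeasurableSet (f i))
      (hd : Pairwise (Function.onFun Disjoint f)) :
      HasSum (fun i => l (ind (f i) (h i))) (l (ind _ (MeasurableSet.iUnion h))) := by
    rw [hasSum_iff_tendsto_nat_of_nonneg fun i => hind _ _]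
    have hsum := fun x => hasSum_indicator_iUnion hd x
    have hval (n : ℕ) (x : X) :
        ((∑ i ∈ Finset.range n, ind (f i) (h i) - ind _ (MeasurableSet.iUnion h) :
          boundedMeasurable X) : X → ℝ) x =
        ∑ i ∈ Finset.range n, (f i).indicator 1 x - (⋃ i, f i).indicator 1 x := by
      simp [Finset.sum_apply]
    have := hcont (fun n => ∑ i ∈ Finset.range n, ind (f i) (h i) -
        ind _ (MeasurableSet.iUnion h)) 1
      (fun n x => by
        rw [hval]
        have hi (i : ℕ) : 0 ≤ (f i).indicator (1 : X → ℝ) x :=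
          Set.indicator_nonneg (fun _ _ => zero_le_one) x
        have h1 := sum_le_hasSum (Finset.range n) (fun i _ => hi i) (hsum x)
        have h2 := Finset.sum_nonneg fun i (_ : i ∈ Finset.range n) => hi i
        have h3 : (⋃ i, f i).indicator (1 : X → ℝ) x ≤ 1 :=
          Set.indicator_le_self' (fun _ _ => zero_le_one) x
        rw [abs_le]
        constructor <;> linarith)
      (fun x => by
        simp only [hval]
        simpa using (hsum x).tendsto_sum_nat.sub_const ((⋃ i, f i).indicator (1 : X → ℝ) x))
    simpa [map_sub, map_sum, tendsto_sub_nhds_zero_iff] using this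
  let μ : Measure X := Measure.ofMeasurable (fun s hs => ENNReal.ofReal (l (ind s hs)))
    (by simp [h0]) fun f h hd => by
      rw [← (hU f h hd).tsum_eq, ENNReal.ofReal_tsum_of_nonneg (fun i => hind _ _)
        (hU f h hd).summable]
  have hμ (s : Set X) (hs : MeasurableSet s) : μ s = ENNReal.ofReal (l (ind s hs)) :=
    Measure.ofMeasurable_apply s hs
  have hfin : IsFiniteMeasure μ := ⟨by rw [hμ _ MeasurableSet.univ]; exact ENNReal.ofReal_lt_top⟩
  refine ⟨μ, hfin, fun u => ?_⟩
  have hsimple (s : SimpleFunc X ℝ) : ∫ x, s x ∂μ = l (ofSimpleFunc s) := by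
    induction s using SimpleFunc.induction with
    | const c hs =>
      rename_i s
      have e : ofSimpleFunc (SimpleFunc.piecewise s hs (SimpleFunc.const _ c)
          (SimpleFunc.const _ 0)) = c • ind s hs := by
        refine Subtype.ext (funext fun x => ?_)
        by_cases hx : x ∈ s <;> simp [ofSimpleFunc, hx]
      have e' : ∀ x, (SimpleFunc.piecewise s hs (SimpleFunc.const _ c)
          (SimpleFunc.const _ 0)) x = s.indicator (fun _ => c) x := fun x => by
        by_cases hx : x ∈ s <;> simp [hx]
      simp_rw [e', e]
      rw [integral_indicator_const c hs, map_smul, measureReal_def, hμ s hs,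
        ENNReal.toReal_ofReal (hind s hs), smul_eq_mul, smul_eq_mul, mul_comm]
    | add _ hf hg =>
      rename_i f g _
      have e : ofSimpleFunc (f + g) = ofSimpleFunc f + ofSimpleFunc g := rfl
      rw [e, map_add, ← hf, ← hg]
      exact integral_add (boundedMeasurable.integrable (ofSimpleFunc f) μ)
        (boundedMeasurable.integrable (ofSimpleFunc g) μ)
  obtain ⟨C, hC⟩ := u.2.2
  have hu := (boundedMeasurable.measurable u).stronglyMeasurable
  have hbd (n : ℕ) (x : X) : |hu.approxBounded |C| n x| ≤ |C| :=
    hu.norm_approxBounded_le (abs_nonneg C) n x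
  have hlim (x : X) : Tendsto (fun n => hu.approxBounded |C| n x) atTop (𝓝 ((u : X → ℝ) x)) :=
    hu.tendsto_approxBounded_of_norm_le ((hC x).trans (le_abs_self C))
  have h1 : Tendsto (fun n => ∫ x, hu.approxBounded |C| n x ∂μ) atTop
      (𝓝 (∫ x, (u : X → ℝ) x ∂μ)) :=
    tendsto_integral_of_dominated_convergence (fun _ => |C|)
      (fun n => (hu.approxBounded |C| n).aestronglyMeasurable) (integrable_const _)
      (fun n => ae_of_all _ (hbd n)) (ae_of_all _ hlim)
  have h2 : Tendsto (fun n => l (ofSimpleFunc (hu.approxBounded |C| n))) atTop (𝓝 (l u)) := by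
    have := hcont (fun n => ofSimpleFunc (hu.approxBounded |C| n) - u) (|C| + |C|)
      (fun n x => (abs_sub _ _).trans
        (add_le_add (hbd n x) ((hC x).trans (le_abs_self C))))
      (fun x => by simpa [ofSimpleFunc] using (hlim x).sub_const ((u : X → ℝ) x))
    simpa only [map_sub, tendsto_sub_nhds_zero_iff] using this
  simp_rw [hsimple] at h1
  exact tendsto_nhds_unique h1 h2

end boundedMeasurable

section Conjugate

variable {β : ℝ → ℝ}

theorem bddAbove_mul_sub_of_superlinear (hβ0 : ∀ x, 0 ≤ β x)
    (hβsl : Tendsto (fun x => β x / x) atTop atTop) {y : ℝ} (hy : 0 ≤ y) :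
    BddAbove {z : ℝ | ∃ x : ℝ, z = x * y - β x} := by
  obtain ⟨M, hM⟩ := eventually_atTop.1
    ((hβsl.eventually_ge_atTop y).and (eventually_gt_atTop 0))
  have hM0 : 0 < M := (hM M le_rfl).2
  refine ⟨M * y, ?_⟩
  rintro _ ⟨x, rfl⟩
  rcases le_total M x with h | h
  · obtain ⟨h1, h2⟩ := hM x h
    rw [le_div_iff₀ h2] at h1
    nlinarith
  · nlinarith [hβ0 x]

theorem mul_sub_le_betaConj (hβ0 : ∀ x, 0 ≤ β x)
    (hβsl : Tendsto (fun x => β x / x) atTop atTop) {y : ℝ} (hy : 0 ≤ y) (x : ℝ) :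
    x * y - β x ≤ betaConj β y :=
  le_csSup (bddAbove_mul_sub_of_superlinear hβ0 hβsl hy) ⟨x, rfl⟩

/-- A maximizer of `x ↦ x * y - β x` among `0` and the first `n` terms of a dense sequence. -/
noncomputable def approxArgmax (β : ℝ → ℝ) : ℕ → ℝ → ℝ
  | 0, _ => 0
  | n + 1, y =>
    if approxArgmax β n y * y - β (approxArgmax β n y) <
        TopologicalSpace.denseSeq ℝ n * y - β (TopologicalSpace.denseSeq ℝ n)
    then TopologicalSpace.denseSeq ℝ n else approxArgmax β n y

theorem measurable_approxArgmax (hβ : Measurable β) (n : ℕ) : Measurable (approxArgmax β n) := by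
  induction n with
  | zero => exact measurable_const
  | succ n ih =>
    refine Measurable.ite (measurableSet_lt ?_ ?_) measurable_const ih
    · exact (ih.mul measurable_id).sub (hβ.comp ih)
    · exact (measurable_id.const_mul _).sub_const _

theorem exists_abs_approxArgmax_le (β : ℝ → ℝ) (n : ℕ) : ∃ C, ∀ y, |approxArgmax β n y| ≤ C := by
  induction n with
  | zero => exact ⟨0, fun y => by simp [approxArgmax]⟩
  | succ n ih =>
    obtain ⟨C, hC⟩ := ih
    refine ⟨max |TopologicalSpace.denseSeq ℝ n| C, fun y => ?_⟩
    rw [approxArgmax]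
    split_ifs
    · exact le_max_left _ _
    · exact (hC y).trans (le_max_right _ _)

theorem approxArgmax_succ_value (β : ℝ → ℝ) (n : ℕ) (y : ℝ) :
    approxArgmax β (n + 1) y * y - β (approxArgmax β (n + 1) y) =
      max (approxArgmax β n y * y - β (approxArgmax β n y))
        (TopologicalSpace.denseSeq ℝ n * y - β (TopologicalSpace.denseSeq ℝ n)) := by
  rw [approxArgmax]
  split_ifs with h
  · rw [max_eq_right h.le]
  · rw [max_eq_left (not_lt.1 h)]

theorem monotone_approxArgmax_value (β : ℝ → ℝ) (y : ℝ) :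
    Monotone fun n => approxArgmax β n y * y - β (approxArgmax β n y) :=
  monotone_nat_of_le_succ fun n => by
    rw [approxArgmax_succ_value]
    exact le_max_left _ _

theorem tendsto_approxArgmax_value (hβ0 : ∀ x, 0 ≤ β x) (hβ : Continuous β)
    (hβsl : Tendsto (fun x => β x / x) atTop atTop) {y : ℝ} (hy : 0 ≤ y) :
    Tendsto (fun n => approxArgmax β n y * y - β (approxArgmax β n y)) atTop
      (𝓝 (betaConj β y)) := by
  refine tendsto_atTop_isLUB (monotone_approxArgmax_value β y) ⟨?_, fun b hb => ?_⟩
  · rintro _ ⟨n, rfl⟩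
    exact mul_sub_le_betaConj hβ0 hβsl hy _
  · have hclosed : IsClosed {x : ℝ | x * y - β x ≤ b} :=
      isClosed_le ((continuous_id.mul continuous_const).sub hβ) continuous_const
    have hsub : Set.range (TopologicalSpace.denseSeq ℝ) ⊆ {x : ℝ | x * y - β x ≤ b} := by
      rintro _ ⟨n, rfl⟩
      refine le_trans ?_ (hb ⟨n + 1, rfl⟩)
      change _ ≤ approxArgmax β (n + 1) y * y - β (approxArgmax β (n + 1) y)
      rw [approxArgmax_succ_value]
      exact le_max_right _ _
    have huniv := (TopologicalSpace.denseRange_denseSeq ℝ).closure_eq.symm.subset.trans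
      (hclosed.closure_subset_iff.2 hsub)
    refine csSup_le ⟨_, 0, rfl⟩ ?_
    rintro _ ⟨x, rfl⟩
    exact huniv (Set.mem_univ x)

end Conjugate

/-- Beppo Levi: the limit of an increasing sequence of integrable functions with bounded
integrals is integrable. -/
theorem integrable_of_tendsto_of_monotone_of_integral_le {α : Type*} [MeasurableSpace α]
    {μ : Measure α} {f : ℕ → α → ℝ} {F : α → ℝ} {C : ℝ} (hf : ∀ n, Integrable (f n) μ)
    (hmono : ∀ x, Monotone fun n => f n x)
    (hlim : ∀ x, Tendsto (fun n => f n x) atTop (𝓝 (F x))) (hC : ∀ n, ∫ x, f n x ∂μ ≤ C) :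
    Integrable F μ ∧ ∫ x, F x ∂μ ≤ C := by
  have hFm : AEStronglyMeasurable F μ :=
    aestronglyMeasurable_of_tendsto_ae atTop (fun n => (hf n).1) (ae_of_all _ hlim)
  have hnn (n : ℕ) (x : α) : 0 ≤ f n x - f 0 x := sub_nonneg.2 (hmono x (Nat.zero_le n))
  have hnnF (x : α) : 0 ≤ F x - f 0 x :=
    ge_of_tendsto' ((hlim x).sub_const (f 0 x)) fun n => hnn n x
  have hl : Tendsto (fun n => ∫⁻ x, ENNReal.ofReal (f n x - f 0 x) ∂μ) atTop
      (𝓝 (∫⁻ x, ENNReal.ofReal (F x - f 0 x) ∂μ)) :=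
    lintegral_tendsto_of_tendsto_of_monotone
      (fun n => ((hf n).sub (hf 0)).aemeasurable.ennreal_ofReal)
      (ae_of_all _ fun x _ _ h => ENNReal.ofReal_le_ofReal (sub_le_sub_right (hmono x h) _))
      (ae_of_all _ fun x => (ENNReal.continuous_ofReal.tendsto _).comp ((hlim x).sub_const _))
  have hle : ∫⁻ x, ENNReal.ofReal (F x - f 0 x) ∂μ ≤ ENNReal.ofReal (C - ∫ x, f 0 x ∂μ) := by
    refine le_of_tendsto' hl fun n => ?_
    have h := ofReal_integral_eq_lintegral_ofReal ((hf n).sub (hf 0)) (ae_of_all _ (hnn n))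
    simp only [Pi.sub_apply] at h
    rw [← h, integral_sub (hf n) (hf 0)]
    exact ENNReal.ofReal_le_ofReal (sub_le_sub_right (hC n) _)
  have hsub : Integrable (fun x => F x - f 0 x) μ := by
    refine ⟨hFm.sub (hf 0).1, ?_⟩
    rw [hasFiniteIntegral_iff_ofReal (ae_of_all _ hnnF)]
    exact hle.trans_lt ENNReal.ofReal_lt_top
  have hF : Integrable F μ := (hsub.add (hf 0)).congr (ae_of_all _ fun x => sub_add_cancel _ _)
  exact ⟨hF, le_of_tendsto' (integral_tendsto_of_tendsto_of_monotone hf hF (ae_of_all _ hmono)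
    (ae_of_all _ hlim)) hC⟩

namespace boundedMeasurable

variable {X : Type*} [MeasurableSpace X] {β : ℝ → ℝ}

theorem integrable_comp (hβ : Continuous β) (u : boundedMeasurable X) (γ : ℝ)
    (θ : Measure X) [IsFiniteMeasure θ] :
    Integrable (fun x => β (γ * (u : X → ℝ) x) / γ) θ := by
  obtain ⟨C, hC⟩ := u.2.2
  obtain ⟨D, hD⟩ := (isCompact_Icc (a := -C) (b := C)).exists_bound_of_continuousOn
    (f := fun t => β (γ * t) / γ) (by fun_prop)
  refine Integrable.of_bound ?_ D (ae_of_all _ fun x => hD _ (abs_le.1 (hC x)))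
  exact ((hβ.measurable.comp ((boundedMeasurable.measurable u).const_mul γ)).div_const
    γ).aestronglyMeasurable

theorem convexOn_integral_comp (hβ : Continuous β) (hβconv : ConvexOn ℝ Set.univ β) {γ : ℝ}
    (hγ : 0 < γ) (θ : Measure X) [IsFiniteMeasure θ] :
    ConvexOn ℝ Set.univ fun u : boundedMeasurable X => ∫ x, β (γ * (u : X → ℝ) x) / γ ∂θ := by
  refine ⟨convex_univ, fun u _ v _ a b ha hb hab => ?_⟩
  have hu := integrable_comp hβ u γ θ
  have hv := integrable_comp hβ v γ θ
  rw [smul_eq_mul, smul_eq_mul, ← integral_const_mul, ← integral_const_mul,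
    ← integral_add (hu.const_mul a) (hv.const_mul b)]
  refine integral_mono (integrable_comp hβ _ γ θ) ((hu.const_mul a).add (hv.const_mul b))
    fun x => ?_
  have h := hβconv.2 (Set.mem_univ (γ * (u : X → ℝ) x)) (Set.mem_univ (γ * (v : X → ℝ) x))
    ha hb hab
  simp only [smul_eq_mul] at h
  change β (γ * (a * (u : X → ℝ) x + b * (v : X → ℝ) x)) / γ ≤
    a * (β (γ * (u : X → ℝ) x) / γ) + b * (β (γ * (v : X → ℝ) x) / γ)
  rw [← mul_div_assoc, ← mul_div_assoc, ← add_div]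
  refine div_le_div_of_nonneg_right ?_ hγ.le
  convert h using 2
  ring

theorem tendsto_integral_comp (hβ : Continuous β) (γ : ℝ)
    (θ : Measure X) [IsFiniteMeasure θ] (u : ℕ → boundedMeasurable X) (v : boundedMeasurable X)
    (C : ℝ) (hC : ∀ n x, |(u n : X → ℝ) x| ≤ C)
    (hlim : ∀ x, Tendsto (fun n => (u n : X → ℝ) x) atTop (𝓝 ((v : X → ℝ) x))) :
    Tendsto (fun n => ∫ x, β (γ * (u n : X → ℝ) x) / γ ∂θ) atTop
      (𝓝 (∫ x, β (γ * (v : X → ℝ) x) / γ ∂θ)) := by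
  have hcont : Continuous fun t => β (γ * t) / γ := by fun_prop
  obtain ⟨D, hD⟩ := (isCompact_Icc (a := -C) (b := C)).exists_bound_of_continuousOn
    hcont.continuousOn
  exact tendsto_integral_of_dominated_convergence (fun _ => D)
    (fun n => (integrable_comp hβ (u n) γ θ).1) (integrable_const _)
    (fun n => ae_of_all _ fun x => hD _ (abs_le.1 (hC n x)))
    (ae_of_all _ fun x => (hcont.tendsto _).comp (hlim x))

/-- A linear functional dominated by `u ↦ ∫ β (γ (f + u)) / γ dθ - V` with `β` nondecreasing is
the integral against a finite measure which is absolutely continuous with respect to `θ`. -/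
theorem exists_measure_absolutelyContinuous (hβ : Continuous β) (hβmono : Monotone β) {γ V : ℝ}
    (hγ : 0 < γ) (θ : Measure X) [IsFiniteMeasure θ] (f : boundedMeasurable X)
    (l : boundedMeasurable X →ₗ[ℝ] ℝ)
    (hl : ∀ u : boundedMeasurable X,
      l u ≤ ∫ x, β (γ * ((f + u : boundedMeasurable X) : X → ℝ) x) / γ ∂θ - V) :
    ∃ μ : Measure X, IsFiniteMeasure μ ∧ μ ≪ θ ∧
      ∀ u : boundedMeasurable X, ∫ x, (u : X → ℝ) x ∂μ = l u := by
  set D := ∫ x, β (γ * (f : X → ℝ) x) / γ ∂θ - V with hD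
  have nonpos_of_le {a : ℝ} (h : ∀ t > 0, t * a ≤ D) : a ≤ 0 := by
    by_contra! ha
    have := h ((|D| + 1) / a) (by positivity)
    rw [div_mul_cancel₀ _ ha.ne'] at this
    linarith [le_abs_self D]
  have hneg (u : boundedMeasurable X) (hu : ∀ᵐ x ∂θ, (u : X → ℝ) x ≤ 0) : l u ≤ 0 := by
    refine nonpos_of_le fun t ht => ?_
    rw [← smul_eq_mul, ← map_smul]
    refine (hl _).trans (sub_le_sub_right ?_ V)
    refine integral_mono_ae (integrable_comp hβ _ γ θ) (integrable_comp hβ _ γ θ) ?_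
    filter_upwards [hu] with x hx
    refine div_le_div_of_nonneg_right (hβmono (mul_le_mul_of_nonneg_left ?_ hγ.le)) hγ.le
    change (f : X → ℝ) x + t * (u : X → ℝ) x ≤ (f : X → ℝ) x
    nlinarith
  have hD0 : 0 ≤ D := by simpa [hD] using hl 0
  have hup (u : ℕ → boundedMeasurable X) (C : ℝ) (hC : ∀ n x, |(u n : X → ℝ) x| ≤ C)
      (hlim : ∀ x, Tendsto (fun n => (u n : X → ℝ) x) atTop (𝓝 0)) (ε : ℝ) (hε : 0 < ε) :
      ∀ᶠ n in atTop, l (u n) < ε := by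
    obtain ⟨K, hK⟩ := f.2.2
    have ht : 0 < (D + 1) / ε := by positivity
    have h := tendsto_integral_comp hβ γ θ (fun n => f + ((D + 1) / ε) • u n) f
      (K + (D + 1) / ε * C)
      (fun n x => by
        refine (abs_add_le _ _).trans (add_le_add (hK x) ?_)
        change |(D + 1) / ε * (u n : X → ℝ) x| ≤ _
        rw [abs_mul, abs_of_pos ht]
        exact mul_le_mul_of_nonneg_left (hC n x) ht.le)
      (fun x => by
        simpa using ((hlim x).const_mul ((D + 1) / ε)).const_add ((f : X → ℝ) x))
    filter_upwards [(h.sub_const V).eventually_lt_const (lt_add_one D)] with n hn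
    have h1 := (hl _).trans_lt hn
    rw [map_smul, smul_eq_mul, div_mul_eq_mul_div, div_lt_iff₀ hε] at h1
    exact lt_of_mul_lt_mul_left h1 (by linarith)
  have hpos (u : boundedMeasurable X) (hu : ∀ x, 0 ≤ (u : X → ℝ) x) : 0 ≤ l u := by
    have := hneg (-u) (ae_of_all _ fun x => neg_nonpos.2 (hu x))
    rwa [map_neg, neg_nonpos] at this
  obtain ⟨μ, hμ, hμl⟩ := exists_measure_integral_eq l hpos fun u C hC hlim => by
    refine tendsto_order.2 ⟨fun a ha => ?_, hup u C hC hlim⟩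
    filter_upwards [hup (fun n => -u n) C (fun n x => (abs_neg _).trans_le (hC n x))
      (fun x => by simpa using (hlim x).neg) (-a) (neg_pos.2 ha)] with n hn
    rw [map_neg] at hn
    linarith
  refine ⟨μ, hμ, Measure.AbsolutelyContinuous.mk fun s hs h0 => ?_, hμl⟩
  have h := hneg (ind s hs) (by
    filter_upwards [measure_eq_zero_iff_ae_notMem.1 h0] with x hx
    simp [hx])
  rw [← hμl, coe_ind, integral_indicator_one hs] at h
  exact (measureReal_eq_zero_iff).1 (le_antisymm h measureReal_nonneg)

/-- If the integral against `μ ≪ θ` is dominated by `u ↦ ∫ β (γ (f + u)) / γ dθ - V`, then the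
conjugate penalty of `dμ/dθ` is integrable and bounded by `γ (∫ f dμ - V)`. -/
theorem integrable_betaConj_rnDeriv (hβ0 : ∀ x, 0 ≤ β x) (hβ : Continuous β)
    (hβsl : Tendsto (fun x => β x / x) atTop atTop) {γ V : ℝ} (hγ : 0 < γ)
    (μ θ : Measure X) [IsFiniteMeasure μ] [IsFiniteMeasure θ] (hμθ : μ ≪ θ)
    (f : boundedMeasurable X)
    (hμ : ∀ u : boundedMeasurable X, ∫ x, (u : X → ℝ) x ∂μ ≤
      ∫ x, β (γ * ((f + u : boundedMeasurable X) : X → ℝ) x) / γ ∂θ - V) :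
    Integrable (fun x => betaConj β ((μ.rnDeriv θ x).toReal)) θ ∧
      ∫ x, betaConj β ((μ.rnDeriv θ x).toReal) ∂θ ≤ γ * (∫ x, (f : X → ℝ) x ∂μ - V) := by
  set Z : X → ℝ := fun x => (μ.rnDeriv θ x).toReal with hZ
  have hZm : Measurable Z := (Measure.measurable_rnDeriv μ θ).ennreal_toReal
  have hex (n : ℕ) : ∃ a : boundedMeasurable X, ∀ x, (a : X → ℝ) x = approxArgmax β n (Z x) := by
    obtain ⟨C, hC⟩ := exists_abs_approxArgmax_le β n
    exact ⟨⟨fun x => approxArgmax β n (Z x),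
      (measurable_approxArgmax hβ.measurable n).comp hZm, C, fun x => hC _⟩, fun _ => rfl⟩
  choose a ha using hex
  have hint1 (n : ℕ) : Integrable (fun x => approxArgmax β n (Z x) * Z x) θ := by
    simpa [ha, mul_comm] using
      (integrable_toReal_rnDeriv_mul_iff hμθ).2 (boundedMeasurable.integrable (a n) μ)
  have hint2 (n : ℕ) : Integrable (fun x => β (approxArgmax β n (Z x))) θ := by
    simpa [ha] using integrable_comp hβ (a n) 1 θ
  refine integrable_of_tendsto_of_monotone_of_integral_le (fun n => (hint1 n).sub (hint2 n))
    (fun x => monotone_approxArgmax_value β (Z x))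
    (fun x => tendsto_approxArgmax_value hβ0 hβ hβsl ENNReal.toReal_nonneg) fun n => ?_
  have h := hμ (γ⁻¹ • a n - f)
  have e1 : ∫ x, ((γ⁻¹ • a n - f : boundedMeasurable X) : X → ℝ) x ∂μ =
      γ⁻¹ * ∫ x, approxArgmax β n (Z x) * Z x ∂θ - ∫ x, (f : X → ℝ) x ∂μ := by
    change ∫ x, (γ⁻¹ * (a n : X → ℝ) x - (f : X → ℝ) x) ∂μ = _
    rw [integral_sub ((boundedMeasurable.integrable (a n) μ).const_mul _)
      (boundedMeasurable.integrable f μ),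
      integral_const_mul,
      ← integral_toReal_rnDeriv_mul hμθ]
    simp_rw [ha, mul_comm, hZ]
  have e2 : ∫ x, β (γ * ((f + (γ⁻¹ • a n - f) : boundedMeasurable X) : X → ℝ) x) / γ ∂θ =
      (∫ x, β (approxArgmax β n (Z x)) ∂θ) / γ := by
    rw [add_sub_cancel, ← integral_div]
    refine integral_congr_ae (ae_of_all _ fun x => ?_)
    change β (γ * (γ⁻¹ * (a n : X → ℝ) x)) / γ = _
    rw [mul_inv_cancel_left₀ hγ.ne', ha]
  rw [e1, e2] at h
  have e3 : ∫ x, (approxArgmax β n (Z x) * Z x - β (approxArgmax β n (Z x))) ∂θ =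
      ∫ x, approxArgmax β n (Z x) * Z x ∂θ - ∫ x, β (approxArgmax β n (Z x)) ∂θ :=
    integral_sub (hint1 n) (hint2 n)
  refine e3.trans_le ?_
  have := mul_le_mul_of_nonneg_left h hγ.le
  rw [mul_sub, mul_sub, mul_inv_cancel_left₀ hγ.ne', mul_div_cancel₀ _ hγ.ne'] at this
  linarith

/-- Bounded continuous functions are bounded measurable functions. -/
def ofBCF [TopologicalSpace X] [BorelSpace X] : (X →ᵇ ℝ) →ₗ[ℝ] boundedMeasurable X where
  toFun f := ⟨f, f.continuous.measurable, ‖f‖, f.norm_coe_le_norm⟩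
  map_add' _ _ := rfl
  map_smul' _ _ := rfl

end boundedMeasurable

section WeakDuality

variable {X : Type*} [TopologicalSpace X] [MeasurableSpace X] [BorelSpace X]

/-- Weak duality between the penalized superhedging problem and its dual. -/
theorem integral_sub_betaConj_le (μ0 θ : Measure X) [IsProbabilityMeasure θ]
    (H : Set (X →ᵇ ℝ)) {β : ℝ → ℝ} (hβ0 : ∀ x, 0 ≤ β x) (hβ : Continuous β)
    (hβsl : Tendsto (fun x => β x / x) atTop atTop) {γ : ℝ} (hγ : 0 < γ)
    (ν : Measure X) (hν : memQ μ0 H ν) (hνθ : ν ≪ θ)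
    (hint : Integrable (fun x => betaConj β ((ν.rnDeriv θ x).toReal)) θ)
    (f h : X →ᵇ ℝ) (hh : h ∈ H) :
    (∫ x, f x ∂ν) - (1 / γ) * ∫ x, betaConj β ((ν.rnDeriv θ x).toReal) ∂θ ≤
      (∫ x, h x ∂μ0) + ∫ x, β (γ * (f x - h x)) / γ ∂θ := by
  have := hν.1
  rw [← hν.2 h hh, sub_le_iff_le_add, add_assoc, ← sub_le_iff_le_add',
    ← integral_sub (f.integrable ν) (h.integrable ν), ← integral_toReal_rnDeriv_mul hνθ,
    ← integral_const_mul]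
  have hi1 : Integrable (fun x => β (γ * (f x - h x)) / γ) θ :=
    boundedMeasurable.integrable_comp hβ (boundedMeasurable.ofBCF (f - h)) γ θ
  rw [← integral_add hi1 (hint.const_mul _)]
  refine integral_mono ((integrable_toReal_rnDeriv_mul_iff hνθ).2
    ((f.integrable ν).sub (h.integrable ν))) (hi1.add (hint.const_mul _)) fun x => ?_
  have key := mul_sub_le_betaConj hβ0 hβsl (y := (ν.rnDeriv θ x).toReal)
    ENNReal.toReal_nonneg (γ * (f x - h x))
  have e : β (γ * (f x - h x)) / γ + 1 / γ * betaConj β ((ν.rnDeriv θ x).toReal) =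
      (β (γ * (f x - h x)) + betaConj β ((ν.rnDeriv θ x).toReal)) / γ := by ring
  change (ν.rnDeriv θ x).toReal * (f x - h x) ≤ β (γ * (f x - h x)) / γ +
    1 / γ * betaConj β ((ν.rnDeriv θ x).toReal)
  rw [e, le_div_iff₀ hγ]
  linarith

end WeakDuality

/-- Dual representation of the regularized superhedging functional:
if some `π ∈ Q` satisfies `π ≪ θ` and `∫ β*(dπ/dθ) dθ < ∞`, then
`φ_{θ,γ}(f) = max_{μ ∈ Q} { ∫ f dμ - (1/γ) ∫ β*(dμ/dθ) dθ }`, the maximum being attained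
(the penalty term being `+∞` for `μ` not absolutely continuous w.r.t. `θ`). -/
theorem statement1 {X : Type*} [TopologicalSpace X] [PolishSpace X]
    [MeasurableSpace X] [BorelSpace X]
    (μ0 θ : Measure X) [IsProbabilityMeasure μ0] [IsProbabilityMeasure θ]
    (H : Submodule ℝ (X →ᵇ ℝ))
    (hconst : ∀ c : ℝ, BoundedContinuousFunction.const X c ∈ H)
    (hca : ∀ fn : ℕ → X →ᵇ ℝ, (∀ x, Antitone (fun n => fn n x)) →
      (∀ x, Tendsto (fun n => fn n x) atTop (𝓝 (0 : ℝ))) →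
      Tendsto (fun n => phi μ0 (H : Set (X →ᵇ ℝ)) (fn n)) atTop (𝓝 (0 : ℝ)))
    (β : ℝ → ℝ) (hβ0 : ∀ x, 0 ≤ β x) (hβdiff : Differentiable ℝ β)
    (hβmono : Monotone β) (hβconv : ConvexOn ℝ Set.univ β)
    (hβsl : Tendsto (fun x => β x / x) atTop atTop)
    (γ : ℝ) (hγ : 0 < γ)
    (π : Measure X) (hπQ : memQ μ0 (H : Set (X →ᵇ ℝ)) π) (hπac : π ≪ θ)
    (hπint : Integrable (fun x => betaConj β ((π.rnDeriv θ x).toReal)) θ)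
    (f : X →ᵇ ℝ) :
    ∃ μ : Measure X, memQ μ0 (H : Set (X →ᵇ ℝ)) μ ∧ μ ≪ θ ∧
      Integrable (fun x => betaConj β ((μ.rnDeriv θ x).toReal)) θ ∧
      phiReg μ0 θ (H : Set (X →ᵇ ℝ)) β γ f =
        (∫ x, f x ∂μ) - (1 / γ) * ∫ x, betaConj β ((μ.rnDeriv θ x).toReal) ∂θ ∧
      ∀ ν : Measure X, memQ μ0 (H : Set (X →ᵇ ℝ)) ν → ν ≪ θ →
        Integrable (fun x => betaConj β ((ν.rnDeriv θ x).toReal)) θ →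
        (∫ x, f x ∂ν) - (1 / γ) * ∫ x, betaConj β ((ν.rnDeriv θ x).toReal) ∂θ ≤
          phiReg μ0 θ (H : Set (X →ᵇ ℝ)) β γ f := by
  have hβ : Continuous β := hβdiff.continuous
  have weak := integral_sub_betaConj_le μ0 θ (H : Set (X →ᵇ ℝ)) hβ0 hβ hβsl hγ
  set V := phiReg μ0 θ (H : Set (X →ᵇ ℝ)) β γ f
  have hV (h : X →ᵇ ℝ) (hh : h ∈ H) :
      V ≤ (∫ x, h x ∂μ0) + ∫ x, β (γ * (f x - h x)) / γ ∂θ := by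
    refine csInf_le ⟨(∫ x, f x ∂π) - (1 / γ) * ∫ x, betaConj β ((π.rnDeriv θ x).toReal) ∂θ, ?_⟩
      ⟨h, hh, rfl⟩
    rintro _ ⟨h', hh', rfl⟩
    exact weak π hπQ hπac hπint f h' hh'
  have hdual (ν : Measure X) (hν : memQ μ0 (H : Set (X →ᵇ ℝ)) ν) (hνθ : ν ≪ θ)
      (hint : Integrable (fun x => betaConj β ((ν.rnDeriv θ x).toReal)) θ) :
      (∫ x, f x ∂ν) - (1 / γ) * ∫ x, betaConj β ((ν.rnDeriv θ x).toReal) ∂θ ≤ V := by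
    refine le_csInf ⟨_, 0, H.zero_mem, rfl⟩ ?_
    rintro _ ⟨h, hh, rfl⟩
    exact weak ν hν hνθ hint f h hh
  let F : boundedMeasurable X := boundedMeasurable.ofBCF f
  let m : H →ₗ[ℝ] ℝ :=
    { toFun := fun h => ∫ x, (h : X →ᵇ ℝ) x ∂μ0
      map_add' := fun h h' => integral_add (h.1.integrable μ0) (h'.1.integrable μ0)
      map_smul' := fun c h => integral_const_mul c _ }
  let ι : H →ₗ[ℝ] boundedMeasurable X := boundedMeasurable.ofBCF.comp H.subtype
  let G : boundedMeasurable X → ℝ := fun u =>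
    ∫ x, β (γ * ((F + u : boundedMeasurable X) : X → ℝ) x) / γ ∂θ - V
  have hG : ConvexOn ℝ Set.univ G :=
    ((boundedMeasurable.convexOn_integral_comp hβ hβconv hγ θ).translate_right F).add_const (-V)
  have hmG (h : H) : m h ≤ G (ι h) := by
    have h1 := hV (-(h : X →ᵇ ℝ)) (H.neg_mem h.2)
    simp only [BoundedContinuousFunction.coe_neg, Pi.neg_apply, integral_neg,
      sub_neg_eq_add] at h1
    change ∫ x, (h : X →ᵇ ℝ) x ∂μ0 ≤ ∫ x, β (γ * (f x + (h : X →ᵇ ℝ) x)) / γ ∂θ - V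
    linarith
  obtain ⟨l, hlH, hl⟩ := exists_linearMap_le_of_convexOn (W := H) hG ι m hmG
  obtain ⟨μ, hμfin, hμθ, hμl⟩ :=
    boundedMeasurable.exists_measure_absolutelyContinuous hβ hβmono hγ θ F l hl
  have hμH (h : X →ᵇ ℝ) (hh : h ∈ H) : ∫ x, h x ∂μ = ∫ x, h x ∂μ0 :=
    (hμl (boundedMeasurable.ofBCF h)).trans (hlH ⟨h, hh⟩)
  have hμQ : memQ μ0 (H : Set (X →ᵇ ℝ)) μ := by
    refine ⟨⟨?_⟩, hμH⟩
    have h1 := hμH _ (hconst 1)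
    simp only [BoundedContinuousFunction.const_apply, integral_const, smul_eq_mul, mul_one,
      probReal_univ] at h1
    rw [← ENNReal.ofReal_toReal (measure_ne_top μ Set.univ), ← measureReal_def, h1,
      ENNReal.ofReal_one]
  obtain ⟨hint, hle⟩ := boundedMeasurable.integrable_betaConj_rnDeriv hβ0 hβ hβsl hγ μ θ hμθ F
    (V := V) fun u => (hμl u).trans_le (hl u)
  refine ⟨μ, hμQ, hμθ, hint, le_antisymm ?_ (hdual μ hμQ hμθ hint), hdual⟩
  change _ ≤ γ * (∫ x, f x ∂μ - V) at hle
  rw [le_sub_comm, one_div, inv_mul_le_iff₀ hγ]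
  exact hle
end

section
/- Let X be Polish, μ0 and θ Borel probability measures, H ⊆ C_b(X) a linear subspace containing constants with superhedging functional φ continuous from above, Q = {μ : ∫ h dμ = ∫ h dμ0 for all h ∈ H}, β a penalty function with conjugate β*, and H^1 ⊆ H^2 ⊆ ⋯ ⊆ H with H^∞ = ∪_m H^m a linear subspace containing the constants satisfying Condition (D). Suppose that for every ε > 0 there exists an ε-optimizer μ_ε ∈ Q of sup_{μ∈Q} ∫ f dμ with μ_ε ≪ θ and ∫ β*(dμ_ε/dθ) dθ < ∞. Then for every f ∈ C_b(X), φ^m_{θ,γ}(f) → φ(f) as min{m, γ} → ∞; i.e., for every ε > 0 there exist m0 ∈ ℕ and γ0 > 0 such that |φ^m_{θ,γ}(f) − φ(f)| ≤ ε for all m ≥ m0 and γ ≥ γ0. -/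
open MeasureTheory BoundedContinuousFunction Filter Topology

/-- Riesz–Markov–Kakutani on a compact space, for functionals on bounded continuous functions. -/
theorem exists_finite_measure_eq_integral_of_compactSpace {Y : Type*} [TopologicalSpace Y]
    [T2Space Y] [CompactSpace Y] [MeasurableSpace Y] [BorelSpace Y]
    (L : (Y →ᵇ ℝ) →ₗ[ℝ] ℝ) (hpos : ∀ g : Y →ᵇ ℝ, (∀ y, 0 ≤ g y) → 0 ≤ L g) :
    ∃ ν : Measure Y, IsFiniteMeasure ν ∧ ∀ g : Y →ᵇ ℝ, ∫ y, g y ∂ν = L g := by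
  let e : CompactlySupportedContinuousMap Y ℝ → (Y →ᵇ ℝ) :=
    fun g => BoundedContinuousFunction.mkOfCompact ⟨g, g.continuous⟩
  let Λ : CompactlySupportedContinuousMap Y ℝ →ₚ[ℝ] ℝ :=
  { toFun g := L (e g)
    map_add' g g' := by
      rw [← map_add]
      rfl
    map_smul' c g := by
      rw [← map_smul]
      rfl
    monotone' g g' hgg' := by
      rw [← sub_nonneg, ← map_sub]
      exact hpos _ fun y => sub_nonneg.2 (hgg' y) }
  refine ⟨RealRMK.rieszMeasure Λ, inferInstance, fun g => ?_⟩
  let g' : CompactlySupportedContinuousMap Y ℝ :=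
  { toFun := g
    hasCompactSupport' := HasCompactSupport.of_compactSpace _ }
  exact RealRMK.integral_rieszMeasure Λ g'

/-- A lower bound for the integrals of continuous majorants of the indicator of a closed set
is a lower bound for its measure. -/
theorem le_measureReal_of_forall_le_integral {Y : Type*} [TopologicalSpace Y]
    [TopologicalSpace.MetrizableSpace Y] [MeasurableSpace Y] [BorelSpace Y]
    (ν : Measure Y) [IsFiniteMeasure ν] {K : Set Y} (hK : IsClosed K) {c : ℝ}
    (hc : ∀ g : Y →ᵇ ℝ, (∀ y, 0 ≤ g y) → (∀ y ∈ K, 1 ≤ g y) → c ≤ ∫ y, g y ∂ν) :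
    c ≤ ν.real K := by
  let _ := TopologicalSpace.metrizableSpaceMetric Y
  have hδ : ∀ n : ℕ, (0 : ℝ) < 1 / (n + 1) := fun n => by positivity
  refine ge_of_tendsto' (tendsto_integral_thickenedIndicator_of_isClosed ν hK hδ
    tendsto_one_div_add_atTop_nhds_zero_nat) fun n => ?_
  let g : Y →ᵇ ℝ := BoundedContinuousFunction.ofNormedAddCommGroup
    (fun y => ((thickenedIndicator (hδ n) K y : NNReal) : ℝ)) (by fun_prop) 1 fun y => by
      simpa using thickenedIndicator_le_one (hδ n) K y
  exact hc g (fun y => NNReal.coe_nonneg _) fun y hy => by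
    have := thickenedIndicator_one (hδ n) K hy
    change (1 : ℝ) ≤ ((thickenedIndicator (hδ n) K y : NNReal) : ℝ)
    rw [this]
    simp

/-- A tight normalized positive linear functional on the bounded continuous functions of a Polish
space is the integral against a probability measure. -/
theorem exists_probabilityMeasure_eq_integral_of_tight {X : Type*} [TopologicalSpace X]
    [PolishSpace X] [MeasurableSpace X] [BorelSpace X]
    (L : (X →ᵇ ℝ) →ₗ[ℝ] ℝ) (hpos : ∀ g : X →ᵇ ℝ, (∀ x, 0 ≤ g x) → 0 ≤ L g)
    (hone : L (BoundedContinuousFunction.const X 1) = 1)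
    (htight : ∀ ε > (0 : ℝ), ∃ u : X →ᵇ ℝ, ∃ K : Set X, IsCompact K ∧ (∀ x, 0 ≤ u x) ∧
      (∀ x ∉ K, 1 ≤ u x) ∧ L u ≤ ε) :
    ∃ ν : Measure X, IsProbabilityMeasure ν ∧ ∀ g : X →ᵇ ℝ, ∫ x, g x ∂ν = L g := by
  have hmono : ∀ g g' : X →ᵇ ℝ, (∀ x, g x ≤ g' x) → L g ≤ L g' := fun g g' h => by
    rw [← sub_nonneg, ← map_sub]
    exact hpos _ fun x => sub_nonneg.2 (h x)
  let _ := TopologicalSpace.metrizableSpaceMetric X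
  obtain ⟨F, hF⟩ := Metric.PiNatEmbed.exists_embedding_to_hilbert_cube (X := X)
  have hFm : MeasurableEmbedding F := hF.continuous.measurableEmbedding hF.injective
  let Fc : C(X, ℕ → unitInterval) := ⟨F, hF.continuous⟩
  let L' : ((ℕ → unitInterval) →ᵇ ℝ) →ₗ[ℝ] ℝ :=
  { toFun g := L (g.compContinuous Fc)
    map_add' g g' := by
      rw [← map_add]
      rfl
    map_smul' c g := by
      rw [← map_smul]
      rfl }
  obtain ⟨m, hmfin, hm⟩ := exists_finite_measure_eq_integral_of_compactSpace L'
    fun g hg => hpos _ fun x => hg _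
  have hmuniv : m.real Set.univ = 1 := by
    have h := hm (BoundedContinuousFunction.const _ 1)
    have h' : L' (BoundedContinuousFunction.const _ 1) = 1 := hone
    rw [h'] at h
    simpa using h
  have hcompact : ∀ ε > (0 : ℝ), ∃ u : X →ᵇ ℝ, ∃ K : Set X, IsCompact K ∧ (∀ x, 0 ≤ u x) ∧
      (∀ x ∉ K, 1 ≤ u x) ∧ L u ≤ ε ∧ m.real (F '' K)ᶜ ≤ ε := by
    intro ε hε
    obtain ⟨u, K, hK, hu0, hu1, huL⟩ := htight ε hε
    refine ⟨u, K, hK, hu0, hu1, huL, ?_⟩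
    have hFK : IsClosed (F '' K) := (hK.image hF.continuous).isClosed
    have hle : 1 - ε ≤ m.real (F '' K) := by
      refine le_measureReal_of_forall_le_integral m hFK fun g hg0 hg1 => ?_
      rw [hm g]
      have h : L (BoundedContinuousFunction.const X 1 - u) ≤ L (g.compContinuous Fc) := by
        refine hmono _ _ fun x => ?_
        change 1 - u x ≤ g (F x)
        by_cases hx : x ∈ K
        · linarith [hu0 x, hg1 _ (Set.mem_image_of_mem F hx)]
        · linarith [hu1 x hx, hg0 (F x)]
      rw [map_sub, hone] at h
      change 1 - ε ≤ L (g.compContinuous Fc)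
      linarith
    rw [measureReal_compl hFK.measurableSet, hmuniv]
    linarith
  have hrange : m (Set.range F)ᶜ = 0 := by
    rw [← measureReal_eq_zero_iff]
    refine le_antisymm (le_of_forall_pos_le_add fun ε hε => ?_) measureReal_nonneg
    obtain ⟨-, K, -, -, -, -, h⟩ := hcompact ε hε
    rw [zero_add]
    exact (measureReal_mono (Set.compl_subset_compl.2 (Set.image_subset_range F K))).trans h
  have hmap : (m.comap F).map F = m := by
    rw [hFm.map_comap, Measure.restrict_eq_self_of_ae_mem]
    exact mem_ae_iff.2 hrange
  have hint : ∀ g : (ℕ → unitInterval) → ℝ, ∫ x, g (F x) ∂(m.comap F) = ∫ y, g y ∂m := fun g => by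
    rw [← hFm.integral_map, hmap]
  have hprob : IsProbabilityMeasure (m.comap F) := by
    constructor
    rw [← Set.preimage_univ (f := F), ← hFm.map_apply, hmap]
    rw [Measure.real, ENNReal.toReal_eq_one_iff] at hmuniv
    exact hmuniv
  refine ⟨m.comap F, hprob, fun g => ?_⟩
  suffices h : ∀ g : X →ᵇ ℝ, L g ≤ ∫ x, g x ∂(m.comap F) by
    refine le_antisymm ?_ (h g)
    have := h (-g)
    rw [map_neg] at this
    simp only [BoundedContinuousFunction.coe_neg, Pi.neg_apply, integral_neg] at this
    linarith
  intro g
  refine le_of_forall_pos_le_add fun ε hε => ?_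
  set M : ℝ := 4 * ‖g‖ + 1 with hM
  have hMpos : 0 < M := by positivity
  obtain ⟨u, K, hK, hu0, hu1, huL, hmK⟩ := hcompact (ε / M) (by positivity)
  have hKcl := hK.isClosed
  have : CompactSpace K := isCompact_iff_compactSpace.1 hK
  obtain ⟨G, hGn, hG⟩ := exists_extension_norm_eq_of_isClosedEmbedding
    (g.compContinuous ⟨((↑) : K → X), continuous_subtype_val⟩)
    (e := fun x : K => F x)
    ((hF.continuous.comp continuous_subtype_val).isClosedEmbedding
      (hF.injective.comp Subtype.val_injective))
  have hGK : ∀ x ∈ K, G (F x) = g x := fun x hx => congrFun hG ⟨x, hx⟩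
  have hGb : ∀ y, |G y| ≤ ‖g‖ := fun y => by
    refine (G.norm_coe_le_norm y).trans (hGn.trans_le ?_)
    exact (BoundedContinuousFunction.norm_le (norm_nonneg g)).2 fun x => g.norm_coe_le_norm _
  have hgb : ∀ x, |g x| ≤ ‖g‖ := g.norm_coe_le_norm
  have h1 : L g ≤ L (G.compContinuous Fc + (2 * ‖g‖) • u) := by
    refine hmono _ _ fun x => ?_
    change g x ≤ G (F x) + 2 * ‖g‖ * u x
    by_cases hx : x ∈ K
    · rw [hGK x hx]
      linarith [mul_nonneg (mul_nonneg zero_le_two (norm_nonneg g)) (hu0 x)]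
    · have := mul_le_mul_of_nonneg_left (hu1 x hx) (mul_nonneg zero_le_two (norm_nonneg g))
      linarith [abs_le.1 (hGb (F x)), abs_le.1 (hgb x)]
  rw [map_add, map_smul, smul_eq_mul] at h1
  have h2 : L (G.compContinuous Fc) = ∫ x, G (F x) ∂(m.comap F) := by
    rw [hint]
    exact (hm G).symm
  have hKc : (m.comap F).real Kᶜ ≤ ε / M := by
    refine le_trans ?_ hmK
    rw [Measure.real, hFm.comap_apply]
    refine measureReal_mono ?_
    rintro _ ⟨x, hx, rfl⟩ ⟨x', hx', h⟩
    exact hx (hF.injective h ▸ hx')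
  have hind : Integrable (Kᶜ.indicator fun _ => 2 * ‖g‖) (m.comap F) :=
    (integrable_const _).indicator hKcl.measurableSet.compl
  have h3 : ∫ x, G (F x) ∂(m.comap F) ≤
      ∫ x, (g x + Kᶜ.indicator (fun _ => 2 * ‖g‖) x) ∂(m.comap F) := by
    refine integral_mono ((G.compContinuous Fc).integrable _) ((g.integrable _).add hind) ?_
    intro x
    by_cases hx : x ∈ K
    · simp [hx, hGK x hx]
    · simp only [Set.indicator_of_mem (Set.mem_compl hx)]
      linarith [abs_le.1 (hGb (F x)), abs_le.1 (hgb x)]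
  rw [integral_add (g.integrable _) hind, integral_indicator_const _ hKcl.measurableSet.compl,
    smul_eq_mul] at h3
  have h4 : ε / M * M = ε := div_mul_cancel₀ _ hMpos.ne'
  have h5 : 0 ≤ ε / M := by positivity
  nlinarith [mul_le_mul_of_nonneg_right hKc (mul_nonneg zero_le_two (norm_nonneg g)),
    mul_le_mul_of_nonneg_left huL (mul_nonneg zero_le_two (norm_nonneg g))]

section Superhedging

variable {X : Type*} [TopologicalSpace X] [MeasurableSpace X]

theorem phi_le_integral [OpensMeasurableSpace X] (μ : Measure X) [IsProbabilityMeasure μ]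
    {S : Set (X →ᵇ ℝ)}
    {f h : X →ᵇ ℝ} (hh : h ∈ S) (hfh : ∀ x, f x ≤ h x) : phi μ S f ≤ ∫ x, h x ∂μ := by
  refine csInf_le ⟨∫ x, f x ∂μ, ?_⟩ ⟨h, hh, hfh, rfl⟩
  rintro _ ⟨g, -, hg, rfl⟩
  exact integral_mono (f.integrable _) (g.integrable _) hg

theorem le_phi_s12 {μ : Measure X} {S : Set (X →ᵇ ℝ)}
    (hconst : ∀ c : ℝ, BoundedContinuousFunction.const X c ∈ S) {f : X →ᵇ ℝ} {a : ℝ}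
    (ha : ∀ h ∈ S, (∀ x, f x ≤ h x) → a ≤ ∫ x, h x ∂μ) : a ≤ phi μ S f := by
  refine le_csInf ⟨_, _, hconst ‖f‖, fun x => ?_, rfl⟩ ?_
  · exact (le_abs_self _).trans (f.norm_coe_le_norm x)
  · rintro _ ⟨h, hh, hfh, rfl⟩
    exact ha h hh hfh

theorem exists_lt_of_phi_lt {μ : Measure X} {S : Set (X →ᵇ ℝ)}
    (hconst : ∀ c : ℝ, BoundedContinuousFunction.const X c ∈ S) {f : X →ᵇ ℝ} {a : ℝ}
    (ha : phi μ S f < a) : ∃ h ∈ S, (∀ x, f x ≤ h x) ∧ ∫ x, h x ∂μ < a := by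
  by_contra! H
  exact ha.not_ge (le_phi_s12 hconst H)

/-- The superhedging value is attained by a positive linear extension of the pricing functional. -/
theorem exists_positive_extension_eq_phi [OpensMeasurableSpace X]
    (μ : Measure X) [IsProbabilityMeasure μ] (S : Submodule ℝ (X →ᵇ ℝ))
    (hconst : ∀ c : ℝ, BoundedContinuousFunction.const X c ∈ S) (f : X →ᵇ ℝ) :
    ∃ L : (X →ᵇ ℝ) →ₗ[ℝ] ℝ, (∀ g : X →ᵇ ℝ, (∀ x, 0 ≤ g x) → 0 ≤ L g) ∧
      (∀ h ∈ S, L h = ∫ x, h x ∂μ) ∧ L f = phi μ (S : Set (X →ᵇ ℝ)) f := by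
  let I : (X →ᵇ ℝ) →ₗ[ℝ] ℝ :=
  { toFun g := ∫ x, g x ∂μ
    map_add' g g' := integral_add (g.integrable _) (g'.integrable _)
    map_smul' c g := integral_smul c g }
  by_cases hf : f ∈ S
  · refine ⟨I, fun g hg => integral_nonneg hg, fun h _ => rfl, le_antisymm ?_ ?_⟩
    · exact le_phi_s12 hconst fun h _ hfh => integral_mono (f.integrable _) (h.integrable _) hfh
    · exact phi_le_integral μ hf fun _ => le_rfl
  let p : (X →ᵇ ℝ) →ₗ.[ℝ] ℝ := ⟨S, I.comp S.subtype⟩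
  let q := p.supSpanSingleton f (phi μ (S : Set (X →ᵇ ℝ)) f) hf
  have hq : ∀ h ∈ S, ∀ c : ℝ, ∀ H, q ⟨h + c • f, H⟩ =
      ∫ x, h x ∂μ + c * phi μ (S : Set (X →ᵇ ℝ)) f := fun h hh c _ =>
    p.supSpanSingleton_apply_mk f _ hf h hh c
  have hmem : ∀ h ∈ S, ∀ c : ℝ, h + c • f ∈ q.domain := fun h hh c =>
    Submodule.mem_sup.2 ⟨h, hh, _, Submodule.mem_span_singleton.2 ⟨c, rfl⟩, rfl⟩
  let C : PointedCone ℝ (X →ᵇ ℝ) :=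
  { carrier := {g | ∀ x, 0 ≤ g x}
    add_mem' := fun ha hb x => add_nonneg (ha x) (hb x)
    zero_mem' := fun _ => le_rfl
    smul_mem' := fun c g hg x => mul_nonneg c.2 (hg x) }
  have hscale : ∀ (c : ℝ) (h : X →ᵇ ℝ), ∫ x, (c • h) x ∂μ = c * ∫ x, h x ∂μ :=
    fun c h => integral_smul c h
  have hnonneg : ∀ g : q.domain, (g : X →ᵇ ℝ) ∈ C → 0 ≤ q g := by
    rintro ⟨g, hg⟩ hgC
    obtain ⟨h, hh, _, hy, rfl⟩ := Submodule.mem_sup.1 hg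
    obtain ⟨c, rfl⟩ := Submodule.mem_span_singleton.1 hy
    rw [hq h hh c]
    have hgC' : ∀ x, 0 ≤ h x + c * f x := hgC
    rcases lt_trichotomy c 0 with hc | rfl | hc
    · have hle : phi μ (S : Set (X →ᵇ ℝ)) f ≤ ∫ x, ((-c)⁻¹ • h) x ∂μ := by
        refine phi_le_integral μ (S.smul_mem _ hh) fun x => ?_
        change f x ≤ (-c)⁻¹ * h x
        rw [inv_mul_eq_div, le_div_iff₀ (neg_pos.2 hc)]
        linarith [hgC' x]
      rw [hscale, inv_mul_eq_div, le_div_iff₀ (neg_pos.2 hc)] at hle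
      linarith
    · have : 0 ≤ ∫ x, h x ∂μ := integral_nonneg fun x => by simpa using hgC' x
      simpa using this
    · have hle : ∫ x, ((-c⁻¹) • h) x ∂μ ≤ phi μ (S : Set (X →ᵇ ℝ)) f := by
        refine le_phi_s12 hconst fun g _ hfg =>
          integral_mono (BoundedContinuousFunction.integrable _ _) (g.integrable _) fun x => ?_
        refine le_trans ?_ (hfg x)
        change -c⁻¹ * h x ≤ f x
        rw [neg_mul, inv_mul_eq_div, neg_le, ← sub_nonneg]
        have : h x / c - -f x = (h x + c * f x) / c := by
          field_simp
          ring
        rw [this]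
        exact div_nonneg (hgC' x) hc.le
      rw [hscale, neg_mul, inv_mul_eq_div, neg_le, ← sub_nonneg] at hle
      have := mul_nonneg hle hc.le
      have h' : (∫ x, h x ∂μ) / c * c = ∫ x, h x ∂μ := div_mul_cancel₀ _ hc.ne'
      linarith
  have hcofinal : ∀ y : X →ᵇ ℝ, ∃ g : q.domain, (g : X →ᵇ ℝ) + y ∈ C := by
    intro y
    refine ⟨⟨_, hmem _ (hconst ‖y‖) 0⟩, fun x => ?_⟩
    have := (abs_le.1 (y.norm_coe_le_norm x)).1
    change 0 ≤ ‖y‖ + 0 * f x + y x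
    linarith
  obtain ⟨L, hL, hLpos⟩ := riesz_extension C q hnonneg hcofinal
  refine ⟨L, hLpos, fun h hh => ?_, ?_⟩
  · have := (hL ⟨_, hmem h hh 0⟩).trans (hq h hh 0 _)
    simpa using this
  · have := (hL ⟨_, hmem 0 S.zero_mem 1⟩).trans (hq 0 S.zero_mem 1 _)
    simpa using this

end Superhedging

/-- If a subspace approximates `H` in every `L¹` space and is tight, it yields the same
superhedging price as `H`. -/
theorem phi_le_phi_of_dense_of_tight {X : Type*} [TopologicalSpace X] [PolishSpace X]
    [MeasurableSpace X] [BorelSpace X] (μ0 : Measure X) [IsProbabilityMeasure μ0]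
    {H S : Submodule ℝ (X →ᵇ ℝ)} (hSH : S ≤ H)
    (hconst : ∀ c : ℝ, BoundedContinuousFunction.const X c ∈ S)
    (hdense : ∀ ε > (0 : ℝ), ∀ μ : Measure X, IsProbabilityMeasure μ →
      ∀ h ∈ H, ∃ h' ∈ S, ∫ x, |h x - h' x| ∂μ ≤ ε)
    (htight : ∀ ε > (0 : ℝ), ∃ u ∈ S, ∃ K : Set X, IsCompact K ∧
        (∀ x, Kᶜ.indicator (fun _ => (1 : ℝ)) x ≤ u x) ∧ ∫ x, u x ∂μ0 ≤ ε)
    (f : X →ᵇ ℝ) : phi μ0 (S : Set (X →ᵇ ℝ)) f ≤ phi μ0 (H : Set (X →ᵇ ℝ)) f := by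
  obtain ⟨L, hLpos, hLS, hLf⟩ := exists_positive_extension_eq_phi μ0 S hconst f
  obtain ⟨ν, hν, hLν⟩ := exists_probabilityMeasure_eq_integral_of_tight L hLpos
    (by simp [hLS _ (hconst 1)]) fun ε hε => by
      obtain ⟨u, hu, K, hK, huK, hint⟩ := htight ε hε
      refine ⟨u, K, hK, fun x => ?_, fun x hx => ?_, (hLS u hu).trans_le hint⟩
      · exact (Set.indicator_nonneg (fun _ _ => zero_le_one) x).trans (huK x)
      · simpa [hx] using huK x
  rw [← hLf]
  refine le_phi_s12 (fun c => hSH (hconst c)) fun h hh hfh => ?_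
  have hLh : L f ≤ ∫ x, h x ∂ν := by
    rw [← hLν f]
    exact integral_mono (f.integrable _) (h.integrable _) hfh
  refine hLh.trans (le_of_forall_pos_le_add fun ε hε => ?_)
  let m : Measure X := (2⁻¹ : ENNReal) • (ν + μ0)
  have hm : IsProbabilityMeasure m := ⟨by
    simp only [m, Measure.smul_apply, Measure.add_apply, measure_univ, smul_eq_mul]
    rw [one_add_one_eq_two, ENNReal.inv_mul_cancel (by simp) (by simp)]⟩
  obtain ⟨h', hh', hd⟩ := hdense (ε / 2) (half_pos hε) m hm h hh
  have habs : ∀ μ : Measure X, IsFiniteMeasure μ → Integrable (fun x => |h x - h' x|) μ :=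
    fun μ _ => ((h - h').integrable μ).abs
  have hdm : ∫ x, |h x - h' x| ∂m =
      2⁻¹ * (∫ x, |h x - h' x| ∂ν + ∫ x, |h x - h' x| ∂μ0) := by
    simp only [m]
    rw [integral_smul_measure, integral_add_measure (habs _ inferInstance) (habs _ inferInstance)]
    simp
  have hbound : ∀ μ : Measure X, IsFiniteMeasure μ →
      |∫ x, h x ∂μ - ∫ x, h' x ∂μ| ≤ ∫ x, |h x - h' x| ∂μ := fun μ _ => by
    rw [← integral_sub (h.integrable _) (h'.integrable _)]
    exact abs_integral_le_integral_abs
  have h1 := abs_le.1 (hbound ν inferInstance)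
  have h2 := abs_le.1 (hbound μ0 inferInstance)
  have h3 : ∫ x, h' x ∂ν = ∫ x, h' x ∂μ0 := (hLν h').trans (hLS h' hh')
  linarith

theorem bddAbove_betaConj_range {β : ℝ → ℝ} (hβ0 : ∀ x, 0 ≤ β x)
    (hβsl : Tendsto (fun x => β x / x) atTop atTop) {y : ℝ} (hy : 0 ≤ y) :
    BddAbove {z : ℝ | ∃ x : ℝ, z = x * y - β x} := by
  obtain ⟨N, hN⟩ := eventually_atTop.1 ((hβsl.eventually_ge_atTop y).and (eventually_gt_atTop 0))
  refine ⟨|N| * y, ?_⟩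
  rintro _ ⟨x, rfl⟩
  rcases le_total x N with hx | hx
  · linarith [hβ0 x, mul_le_mul_of_nonneg_right (hx.trans (le_abs_self N)) hy]
  · obtain ⟨h1, h2⟩ := hN x hx
    rw [le_div_iff₀ h2] at h1
    linarith [mul_nonneg (abs_nonneg N) hy]

theorem integrable_beta_comp {X : Type*} [TopologicalSpace X] [MeasurableSpace X]
    [OpensMeasurableSpace X] (θ : Measure X) [IsFiniteMeasure θ] {β : ℝ → ℝ}
    (hβ0 : ∀ x, 0 ≤ β x) (hβc : Continuous β) (hβmono : Monotone β) (g : X →ᵇ ℝ) :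
    Integrable (fun x => β (g x)) θ := by
  refine Integrable.of_bound (hβc.measurable.comp g.continuous.measurable).aestronglyMeasurable
    (β ‖g‖) (ae_of_all _ fun x => ?_)
  rw [Real.norm_of_nonneg (hβ0 _)]
  exact hβmono ((le_abs_self _).trans (g.norm_coe_le_norm x))

/-- The integrated Fenchel–Young inequality. -/
theorem integral_le_integral_beta_add {X : Type*} [TopologicalSpace X] [MeasurableSpace X]
    [OpensMeasurableSpace X] (θ μ : Measure X) [IsProbabilityMeasure θ] [IsProbabilityMeasure μ]
    (hμθ : μ ≪ θ) {β : ℝ → ℝ} (hβ0 : ∀ x, 0 ≤ β x) (hβc : Continuous β) (hβmono : Monotone β)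
    (hβsl : Tendsto (fun x => β x / x) atTop atTop)
    (hint : Integrable (fun x => betaConj β ((μ.rnDeriv θ x).toReal)) θ) (g : X →ᵇ ℝ) :
    ∫ x, g x ∂μ ≤ ∫ x, β (g x) ∂θ + ∫ x, betaConj β ((μ.rnDeriv θ x).toReal) ∂θ := by
  rw [← integral_add (integrable_beta_comp θ hβ0 hβc hβmono g) hint,
    ← integral_rnDeriv_smul hμθ]
  refine integral_mono ((integrable_rnDeriv_smul_iff hμθ).2 (g.integrable _))
    ((integrable_beta_comp θ hβ0 hβc hβmono g).add hint) fun x => ?_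
  have := le_csSup (bddAbove_betaConj_range hβ0 hβsl
    (ENNReal.toReal_nonneg (a := μ.rnDeriv θ x))) ⟨g x, rfl⟩
  change (μ.rnDeriv θ x).toReal * g x ≤ β (g x) + betaConj β ((μ.rnDeriv θ x).toReal)
  rw [betaConj]
  linarith

/-- Under Condition (D) and the existence, for every `ε > 0`, of an
`ε`-optimizer `μ_ε ∈ Q` of `sup_{μ ∈ Q} ∫ f dμ` with `μ_ε ≪ θ` and `∫ β*(dμ_ε/dθ) dθ < ∞`,
one has `φ^m_{θ,γ}(f) → φ(f)` as `min{m, γ} → ∞`. -/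
theorem statement12 {X : Type*} [TopologicalSpace X] [PolishSpace X]
    [MeasurableSpace X] [BorelSpace X]
    (μ0 θ : Measure X) [IsProbabilityMeasure μ0] [IsProbabilityMeasure θ]
    (H : Submodule ℝ (X →ᵇ ℝ))
    (hconst : ∀ c : ℝ, BoundedContinuousFunction.const X c ∈ H)
    (hca : ∀ fn : ℕ → X →ᵇ ℝ, (∀ x, Antitone (fun n => fn n x)) →
      (∀ x, Tendsto (fun n => fn n x) atTop (𝓝 (0 : ℝ))) →
      Tendsto (fun n => phi μ0 (H : Set (X →ᵇ ℝ)) (fn n)) atTop (𝓝 (0 : ℝ)))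
    (β : ℝ → ℝ) (hβ0 : ∀ x, 0 ≤ β x) (hβdiff : Differentiable ℝ β)
    (hβmono : Monotone β) (hβconv : ConvexOn ℝ Set.univ β)
    (hβsl : Tendsto (fun x => β x / x) atTop atTop)
    (Hm : ℕ → Set (X →ᵇ ℝ))
    (hHmsub : ∀ m, Hm m ⊆ (H : Set (X →ᵇ ℝ))) (hHmmono : Monotone Hm)
    (haddI : ∀ g ∈ ⋃ m, Hm m, ∀ h ∈ ⋃ m, Hm m, g + h ∈ ⋃ m, Hm m)
    (hsmulI : ∀ c : ℝ, ∀ h ∈ ⋃ m, Hm m, c • h ∈ ⋃ m, Hm m)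
    (hconstI : ∀ c : ℝ, BoundedContinuousFunction.const X c ∈ ⋃ m, Hm m)
    (hD1 : ∀ ε > (0 : ℝ), ∀ μ : Measure X, IsProbabilityMeasure μ →
      ∀ h ∈ H, ∃ h' ∈ ⋃ m, Hm m, ∫ x, |h x - h' x| ∂μ ≤ ε)
    (hD2 : ∀ ε > (0 : ℝ), ∀ μ : Measure X, IsProbabilityMeasure μ →
      ∃ h'' ∈ ⋃ m, Hm m, ∃ K : Set X, IsCompact K ∧
        (∀ x, Kᶜ.indicator (fun _ => (1 : ℝ)) x ≤ h'' x) ∧ ∫ x, h'' x ∂μ ≤ ε)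
    (f : X →ᵇ ℝ)
    (hopt : ∀ ε > (0 : ℝ), ∃ με : Measure X, memQ μ0 (H : Set (X →ᵇ ℝ)) με ∧
      phi μ0 (H : Set (X →ᵇ ℝ)) f - ε ≤ ∫ x, f x ∂με ∧ με ≪ θ ∧
      Integrable (fun x => betaConj β ((με.rnDeriv θ x).toReal)) θ) :
    ∀ ε > (0 : ℝ), ∃ (m0 : ℕ) (γ0 : ℝ), 0 < γ0 ∧
      ∀ m ≥ m0, ∀ γ ≥ γ0,
        |phiReg μ0 θ (Hm m) β γ f - phi μ0 (H : Set (X →ᵇ ℝ)) f| ≤ ε := by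
  intro ε hε
  let S : Submodule ℝ (X →ᵇ ℝ) :=
  { carrier := ⋃ m, Hm m
    add_mem' := fun {a b} ha hb => haddI a ha b hb
    zero_mem' := hconstI 0
    smul_mem' := fun c h hh => hsmulI c h hh }
  have hSH : S ≤ H := Set.iUnion_subset hHmsub
  have hphi : phi μ0 (S : Set (X →ᵇ ℝ)) f ≤ phi μ0 (H : Set (X →ᵇ ℝ)) f :=
    phi_le_phi_of_dense_of_tight μ0 hSH hconstI hD1 (fun ε hε => hD2 ε hε μ0 inferInstance) f
  obtain ⟨h, hhS, hfh, hhint⟩ := exists_lt_of_phi_lt (S := (S : Set (X →ᵇ ℝ))) hconstI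
    (hphi.trans_lt (lt_add_of_pos_right _ (half_pos hε)))
  obtain ⟨m0, hm0⟩ := Set.mem_iUnion.1 (show h ∈ ⋃ m, Hm m from hhS)
  obtain ⟨με, ⟨hprob, hQ⟩, hopt', hac, hconj⟩ := hopt (ε / 2) (half_pos hε)
  set C := ∫ x, betaConj β ((με.rnDeriv θ x).toReal) ∂θ with hC
  refine ⟨m0, 2 * (β 0 + |C| + 1) / ε, by have := hβ0 0; positivity, fun m hm γ hγ => ?_⟩
  have hγ0 : 0 < γ := lt_of_lt_of_le (by have := hβ0 0; positivity) hγ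
  have hγε : β 0 + |C| + 1 ≤ γ * ε / 2 := by
    rw [ge_iff_le, div_le_iff₀ hε] at hγ
    linarith
  have hlow : ∀ g ∈ Hm m, phi μ0 (H : Set (X →ᵇ ℝ)) f - ε ≤
      ∫ x, g x ∂μ0 + ∫ x, β (γ * (f x - g x)) / γ ∂θ := by
    intro g hg
    have hy := integral_le_integral_beta_add θ με hac hβ0 hβdiff.continuous hβmono hβsl hconj
      (γ • (f - g))
    simp only [BoundedContinuousFunction.coe_smul, BoundedContinuousFunction.coe_sub,
      Pi.sub_apply, smul_eq_mul] at hy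
    rw [integral_const_mul, integral_sub (f.integrable _) (g.integrable _),
      hQ g (hHmsub m hg)] at hy
    rw [integral_div]
    have hCle : C / γ ≤ ε / 2 := by
      rw [div_le_iff₀ hγ0]
      linarith [le_abs_self C, hβ0 0]
    have hdiv : ∫ x, f x ∂με - ∫ x, g x ∂μ0 ≤
        (∫ x, β (γ * (f x - g x)) ∂θ) / γ + C / γ := by
      rw [← add_div, le_div_iff₀ hγ0]
      linarith
    linarith
  have hmem : h ∈ Hm m := hHmmono hm hm0
  rw [abs_le]
  constructor
  · have : phi μ0 (H : Set (X →ᵇ ℝ)) f - ε ≤ phiReg μ0 θ (Hm m) β γ f := by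
      refine le_csInf ⟨_, h, hmem, rfl⟩ ?_
      rintro _ ⟨g, hg, rfl⟩
      exact hlow g hg
    linarith
  · have hle : phiReg μ0 θ (Hm m) β γ f ≤
        ∫ x, h x ∂μ0 + ∫ x, β (γ * (f x - h x)) / γ ∂θ := by
      refine csInf_le ⟨phi μ0 (H : Set (X →ᵇ ℝ)) f - ε, ?_⟩ ⟨h, hmem, rfl⟩
      rintro _ ⟨g, hg, rfl⟩
      exact hlow g hg
    have hpen : ∫ x, β (γ * (f x - h x)) / γ ∂θ ≤ ∫ _, β 0 / γ ∂θ := by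
      refine integral_mono ((integrable_beta_comp θ hβ0 hβdiff.continuous hβmono
        (γ • (f - h))).div_const γ) (integrable_const _) fun x => ?_
      exact div_le_div_of_nonneg_right (hβmono
        (mul_nonpos_of_nonneg_of_nonpos hγ0.le (sub_nonpos.2 (hfh x)))) hγ0.le
    have hβle : β 0 / γ ≤ ε / 2 := by
      rw [div_le_iff₀ hγ0]
      linarith [abs_nonneg C]
    rw [integral_const, probReal_univ, one_smul] at hpen
    linarith
end

section
/- Let X be Polish, μ0 and θ Borel probability measures with θ strictly positive (θ(U) > 0 for every nonempty open U ⊆ X), and let β be a penalty function with β_γ(x) = β(γx)/γ. Let A ↦ η(A) be a map from a compact metric space 𝒜 into C_b(X) that is continuous into both L^1(μ0) and L^1(θ), with {η(A) : A ∈ 𝒜} uniformly bounded, and set 𝓗 = {η(A) + a : A ∈ 𝒜, a ∈ ℝ}. Define ψ(f) = inf{∫ h dμ0 : h ∈ 𝓗, h ≥ f} and ψ_γ(f) = inf_{h∈𝓗}{∫ h dμ0 + ∫ β_γ(f − h) dθ}. Then for every f ∈ C_b(X), ψ_γ(f) → ψ(f) as γ → ∞. -/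
open MeasureTheory BoundedContinuousFunction Filter Topology

/-- A nonnegative function of superlinear growth dominates every multiple of the positive part,
up to a constant. -/
lemma exists_mul_posPart_sub_le {β : ℝ → ℝ} (hβ0 : ∀ x, 0 ≤ β x)
    (hβsl : Tendsto (fun x => β x / x) atTop atTop) {L : ℝ} (hL : 0 ≤ L) :
    ∃ K : ℝ, ∀ y, L * max y 0 - K ≤ β y := by
  obtain ⟨x₀, h⟩ := ((eventually_gt_atTop (0 : ℝ)).and
    (hβsl.eventually_ge_atTop L)).exists_forall_of_atTop
  have hx₀ := (h x₀ le_rfl).1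
  refine ⟨L * x₀, fun y => ?_⟩
  rcases le_total x₀ y with hy | hy
  · obtain ⟨hy0, hLy⟩ := h y hy
    rw [le_div_iff₀ hy0] at hLy
    rw [max_eq_left hy0.le]
    linarith [mul_nonneg hL hx₀.le]
  · have : L * max y 0 ≤ L * x₀ := mul_le_mul_of_nonneg_left (max_le hy hx₀.le) hL
    linarith [hβ0 y]

/-- A family of integrals is continuous when its integrands vary less than a family which is
continuous in `L¹`. -/
lemma tendsto_integral_of_abs_sub_le {X T : Type*} [MeasurableSpace X]
    [TopologicalSpace T] {μ : Measure X}
    {G D : T → X → ℝ} {t₀ : T} (hG : ∀ t, Integrable (G t) μ) (hD : ∀ t, Integrable (D t) μ)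
    (hle : ∀ t x, |G t x - G t₀ x| ≤ D t x)
    (hlim : Tendsto (fun t => ∫ x, D t x ∂μ) (𝓝 t₀) (𝓝 0)) :
    Tendsto (fun t => ∫ x, G t x ∂μ) (𝓝 t₀) (𝓝 (∫ x, G t₀ x ∂μ)) := by
  rw [tendsto_iff_norm_sub_tendsto_zero]
  refine squeeze_zero (fun _ => norm_nonneg _) (fun t => ?_) hlim
  rw [← integral_sub (hG t) (hG t₀)]
  exact norm_integral_le_of_norm_le (hD t) (Eventually.of_forall fun x => hle t x)

section

variable {X : Type*} [TopologicalSpace X] [MeasurableSpace X] [BorelSpace X]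

lemma integrable_posPart_sub (θ : Measure X) [IsFiniteMeasure θ] (f h : X →ᵇ ℝ) :
    Integrable (fun x => max (f x - h x) 0) θ :=
  ((f.integrable θ).sub (h.integrable θ)).pos_part

lemma integrable_abs_sub (μ : Measure X) [IsFiniteMeasure μ] (g h : X →ᵇ ℝ) :
    Integrable (fun x => |g x - h x|) μ :=
  ((g.integrable μ).sub (h.integrable μ)).abs

lemma integrable_penalty (θ : Measure X) [IsFiniteMeasure θ] {β : ℝ → ℝ}
    (hβ0 : ∀ x, 0 ≤ β x) (hβ : Continuous β) (hβmono : Monotone β) {γ : ℝ} (hγ : 0 < γ)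
    (f h : X →ᵇ ℝ) : Integrable (fun x => β (γ * (f x - h x)) / γ) θ := by
  refine Integrable.div_const ?_ γ
  refine Integrable.of_bound (C := β (γ * ‖f - h‖)) ?_ ?_
  · exact (hβ.comp (continuous_const.mul (f.continuous.sub h.continuous))).measurable
      |>.aestronglyMeasurable
  · refine Eventually.of_forall fun x => ?_
    rw [Real.norm_of_nonneg (hβ0 _)]
    exact hβmono (mul_le_mul_of_nonneg_left
      ((le_abs_self _).trans ((f - h).norm_coe_le_norm x)) hγ.le)

lemma mul_integral_posPart_sub_le (θ : Measure X) [IsProbabilityMeasure θ] {β : ℝ → ℝ}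
    (hβ0 : ∀ x, 0 ≤ β x) (hβ : Continuous β) (hβmono : Monotone β) {γ : ℝ} (hγ : 0 < γ)
    {L K : ℝ} (hK : ∀ y, L * max y 0 - K ≤ β y) (f h : X →ᵇ ℝ) :
    L * (∫ x, max (f x - h x) 0 ∂θ) - K / γ ≤ ∫ x, β (γ * (f x - h x)) / γ ∂θ := by
  have hi := (integrable_posPart_sub θ f h).const_mul L
  calc L * (∫ x, max (f x - h x) 0 ∂θ) - K / γ
      = ∫ x, (L * max (f x - h x) 0 - K / γ) ∂θ := by
        rw [integral_sub hi (integrable_const _), integral_const_mul]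
        simp
    _ ≤ _ := by
        refine integral_mono (hi.sub (integrable_const _))
          (integrable_penalty θ hβ0 hβ hβmono hγ f h) fun x => ?_
        have := hK (γ * (f x - h x))
        rw [show max (γ * (f x - h x)) 0 = γ * max (f x - h x) 0 by
          rw [mul_max_of_nonneg _ _ hγ.le, mul_zero]] at this
        change L * max (f x - h x) 0 - K / γ ≤ β (γ * (f x - h x)) / γ
        rw [le_div_iff₀ hγ, sub_mul, div_mul_cancel₀ _ hγ.ne']
        linarith

lemma tendsto_integral_abs_sub_add_abs_sub {𝒜 : Type*} [TopologicalSpace 𝒜] (μ : Measure X)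
    [IsProbabilityMeasure μ] {η : 𝒜 → (X →ᵇ ℝ)} {A₀ : 𝒜}
    (hη : Tendsto (fun A => ∫ x, |η A x - η A₀ x| ∂μ) (𝓝 A₀) (𝓝 0)) (a₀ : ℝ) :
    Tendsto (fun p : 𝒜 × ℝ => ∫ x, (|η p.1 x - η A₀ x| + |p.2 - a₀|) ∂μ) (𝓝 (A₀, a₀)) (𝓝 0) := by
  have h1 : Tendsto (fun p : 𝒜 × ℝ => ∫ x, |η p.1 x - η A₀ x| ∂μ) (𝓝 (A₀, a₀)) (𝓝 0) :=
    hη.comp (continuous_fst.tendsto (A₀, a₀))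
  have h2 : Tendsto (fun p : 𝒜 × ℝ => |p.2 - a₀|) (𝓝 (A₀, a₀)) (𝓝 0) := by
    have : Continuous fun p : 𝒜 × ℝ => |p.2 - a₀| := by fun_prop
    simpa using this.tendsto (A₀, a₀)
  have h3 := h1.add h2
  rw [add_zero] at h3
  refine h3.congr fun p => ?_
  rw [integral_add (integrable_abs_sub μ (η p.1) (η A₀)) (integrable_const _)]
  simp

lemma continuous_integral_shift {𝒜 : Type*} [TopologicalSpace 𝒜] (μ : Measure X)
    [IsProbabilityMeasure μ] {η : 𝒜 → (X →ᵇ ℝ)}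
    (hη : ∀ A₀, Tendsto (fun A => ∫ x, |η A x - η A₀ x| ∂μ) (𝓝 A₀) (𝓝 0)) :
    Continuous fun p : 𝒜 × ℝ => ∫ x, (η p.1 + const X p.2) x ∂μ := by
  refine continuous_iff_continuousAt.2 fun p₀ => ?_
  refine tendsto_integral_of_abs_sub_le (t₀ := p₀) (fun p => (η p.1 + const X p.2).integrable μ)
    (fun p => (integrable_abs_sub μ (η p.1) (η p₀.1)).add (integrable_const _))
    (fun p x => ?_) (tendsto_integral_abs_sub_add_abs_sub μ (hη p₀.1) p₀.2)
  refine le_trans (le_of_eq ?_) (abs_add_le _ _)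
  simp only [coe_add, Pi.add_apply, const_apply]
  congr 1
  ring

lemma continuous_integral_posPart_sub_shift {𝒜 : Type*} [TopologicalSpace 𝒜] (μ : Measure X)
    [IsProbabilityMeasure μ] {η : 𝒜 → (X →ᵇ ℝ)}
    (hη : ∀ A₀, Tendsto (fun A => ∫ x, |η A x - η A₀ x| ∂μ) (𝓝 A₀) (𝓝 0)) (f : X →ᵇ ℝ) :
    Continuous fun p : 𝒜 × ℝ => ∫ x, max (f x - (η p.1 + const X p.2) x) 0 ∂μ := by
  refine continuous_iff_continuousAt.2 fun p₀ => ?_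
  refine tendsto_integral_of_abs_sub_le (t₀ := p₀)
    (fun p => integrable_posPart_sub μ f (η p.1 + const X p.2))
    (fun p => (integrable_abs_sub μ (η p.1) (η p₀.1)).add (integrable_const _))
    (fun p x => ?_) (tendsto_integral_abs_sub_add_abs_sub μ (hη p₀.1) p₀.2)
  refine (abs_max_sub_max_le_abs _ _ _).trans (le_trans (le_of_eq ?_) (abs_add_le _ _))
  rw [← abs_neg]
  simp only [coe_add, Pi.add_apply, const_apply]
  congr 1
  ring

lemma le_of_integral_posPart_sub_nonpos {θ : Measure X} [IsFiniteMeasure θ]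
    (hθpos : ∀ U : Set X, IsOpen U → U.Nonempty → 0 < θ U) {f h : X →ᵇ ℝ}
    (hint : ∫ x, max (f x - h x) 0 ∂θ ≤ 0) (x : X) : f x ≤ h x := by
  have : θ.IsOpenPosMeasure := ⟨fun U hU hne => (hθpos U hU hne).ne'⟩
  have hnn : 0 ≤ fun x => max (f x - h x) 0 := fun x => le_max_right _ _
  have hae := (integral_eq_zero_iff_of_nonneg hnn (integrable_posPart_sub θ f h)).1
    (le_antisymm hint (integral_nonneg hnn))
  have hcont : Continuous fun x => max (f x - h x) 0 :=
    (f.continuous.sub h.continuous).max continuous_const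
  have : max (f x - h x) 0 = 0 := congrFun ((hcont.ae_eq_iff_eq θ continuous_const).1 hae) x
  exact sub_nonpos.1 (max_eq_right_iff.1 this)

lemma integral_shift_mem_Icc {μ : Measure X} [IsProbabilityMeasure μ] {g : X →ᵇ ℝ} {C : ℝ}
    (hg : ∀ x, |g x| ≤ C) (a : ℝ) :
    ∫ x, (g + const X a) x ∂μ ∈ Set.Icc (a - C) (a + C) := by
  have hi := (g + const X a).integrable μ
  constructor
  · have := integral_mono (integrable_const (a - C)) hi
      fun x => by simpa using (by linarith [(abs_le.1 (hg x)).1] : a - C ≤ g x + a)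
    simpa using this
  · have := integral_mono hi (integrable_const (a + C))
      fun x => by simpa using (by linarith [(abs_le.1 (hg x)).2] : g x + a ≤ a + C)
    simpa using this

lemma sub_le_integral_posPart_sub_shift {θ : Measure X} [IsProbabilityMeasure θ] {g : X →ᵇ ℝ}
    {C : ℝ} (hg : ∀ x, |g x| ≤ C) (f : X →ᵇ ℝ) (a : ℝ) :
    -‖f‖ - C - a ≤ ∫ x, max (f x - (g + const X a) x) 0 ∂θ := by
  have := integral_mono (integrable_const (-‖f‖ - C - a))
    (integrable_posPart_sub θ f (g + const X a)) fun x => by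
      refine le_trans ?_ (le_max_left _ _)
      have h1 := (abs_le.1 (hg x)).2
      have h2 := (abs_le.1 (f.norm_coe_le_norm x)).1
      simp only [coe_add, Pi.add_apply, const_apply]
      linarith
  simpa using this

end

/-- Let `θ` be strictly positive, `𝒜` a compact metric space,
`A ↦ η(A) ∈ C_b(X)` continuous into `L¹(μ0)` and `L¹(θ)` with `{η(A)}` uniformly bounded, and
`𝓗 = {η(A) + a : A ∈ 𝒜, a ∈ ℝ}`. Then the penalized values `ψ_γ(f)` converge to the
constrained (superhedging) value `ψ(f)` as `γ → ∞`, for every `f ∈ C_b(X)`. -/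
theorem statement16 {X : Type*} [TopologicalSpace X] [PolishSpace X]
    [MeasurableSpace X] [BorelSpace X]
    (μ0 θ : Measure X) [IsProbabilityMeasure μ0] [IsProbabilityMeasure θ]
    (hθpos : ∀ U : Set X, IsOpen U → U.Nonempty → 0 < θ U)
    (β : ℝ → ℝ) (hβ0 : ∀ x, 0 ≤ β x) (hβdiff : Differentiable ℝ β)
    (hβmono : Monotone β) (hβconv : ConvexOn ℝ Set.univ β)
    (hβsl : Tendsto (fun x => β x / x) atTop atTop)
    (𝒜 : Type*) [MetricSpace 𝒜] [CompactSpace 𝒜]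
    (η : 𝒜 → (X →ᵇ ℝ))
    (hcont0 : ∀ A0 : 𝒜, Tendsto (fun A => ∫ x, |η A x - η A0 x| ∂μ0) (𝓝 A0) (𝓝 (0 : ℝ)))
    (hcontθ : ∀ A0 : 𝒜, Tendsto (fun A => ∫ x, |η A x - η A0 x| ∂θ) (𝓝 A0) (𝓝 (0 : ℝ)))
    (C : ℝ) (hbd : ∀ (A : 𝒜) (x : X), |η A x| ≤ C)
    (f : X →ᵇ ℝ) :
    Tendsto
      (fun γ : ℝ => phiReg μ0 θ
        {h : X →ᵇ ℝ | ∃ (A : 𝒜) (a : ℝ), h = η A + BoundedContinuousFunction.const X a}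
        β γ f)
      atTop
      (𝓝 (phi μ0
        {h : X →ᵇ ℝ | ∃ (A : 𝒜) (a : ℝ), h = η A + BoundedContinuousFunction.const X a}
        f)) := by
  set H : Set (X →ᵇ ℝ) := {h | ∃ (A : 𝒜) (a : ℝ), h = η A + const X a}
  rcases isEmpty_or_nonempty 𝒜 with h𝒜 | ⟨⟨A₁⟩⟩
  · have hHe : H = ∅ := Set.eq_empty_of_forall_notMem fun h ⟨A, _⟩ => h𝒜.elim A
    simp [hHe, phi, phiReg]
  have hβ := hβdiff.continuous
  have hmem : ∀ A a, η A + const X a ∈ H := fun A a => ⟨A, a, rfl⟩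
  have hphi : ∀ h ∈ H, (∀ x, f x ≤ h x) → phi μ0 H f ≤ ∫ x, h x ∂μ0 := fun h hh hle => by
    refine csInf_le ⟨∫ x, f x ∂μ0, ?_⟩ ⟨h, hh, hle, rfl⟩
    rintro _ ⟨k, -, hk, rfl⟩
    exact integral_mono (f.integrable μ0) (k.integrable μ0) hk
  obtain ⟨K₁, hK₁⟩ := exists_mul_posPart_sub_le hβ0 hβsl zero_le_one
  obtain ⟨K₂, hK₂⟩ := exists_mul_posPart_sub_le hβ0 hβsl zero_le_two
  have hupper : ∀ γ : ℝ, 0 < γ → phiReg μ0 θ H β γ f ≤ phi μ0 H f + β 0 / γ := fun γ hγ => by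
    rw [← sub_le_iff_le_add]
    refine le_csInf ⟨_, η A₁ + const X (‖f‖ + C), hmem _ _, fun x => ?_, rfl⟩ ?_
    · have h1 := (abs_le.1 (hbd A₁ x)).1
      have h2 := (abs_le.1 (f.norm_coe_le_norm x)).2
      simp only [coe_add, Pi.add_apply, const_apply]
      linarith
    rintro _ ⟨h, hh, hle, rfl⟩
    have hpen : ∫ x, β (γ * (f x - h x)) / γ ∂θ ≤ β 0 / γ := by
      have := integral_mono (integrable_penalty θ hβ0 hβ hβmono hγ f h)
        (integrable_const (β 0 / γ)) fun x => div_le_div_of_nonneg_right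
          (hβmono (mul_nonpos_of_nonneg_of_nonpos hγ.le (sub_nonpos.2 (hle x)))) hγ.le
      simpa using this
    have hinf : phiReg μ0 θ H β γ f ≤ (∫ x, h x ∂μ0) + ∫ x, β (γ * (f x - h x)) / γ ∂θ := by
      refine csInf_le ⟨-‖f‖ - 2 * C - K₁ / γ, ?_⟩ ⟨h, hh, rfl⟩
      rintro _ ⟨_, ⟨A, a, rfl⟩, rfl⟩
      have h1 := mul_integral_posPart_sub_le θ hβ0 hβ hβmono hγ hK₁ f (η A + const X a)
      have h2 := sub_le_integral_posPart_sub_shift (θ := θ) (hbd A) f a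
      have h3 := (integral_shift_mem_Icc (μ := μ0) (hbd A) a).1
      linarith
    linarith
  refine tendsto_order.2 ⟨fun m hm => ?_, fun m hm => ?_⟩
  · by_contra hcon
    have hfreq : ∃ᶠ γ in atTop, ¬ m < phiReg μ0 θ H β γ f := not_eventually.1 hcon
    obtain ⟨γ, hγlim, hγ⟩ := exists_seq_forall_of_frequently
      (hfreq.and_eventually (eventually_ge_atTop 1))
    obtain ⟨M, hmM, hM⟩ := exists_between hm
    have hex : ∀ n, ∃ p : 𝒜 × ℝ, (∫ x, (η p.1 + const X p.2) x ∂μ0)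
        + ∫ x, β (γ n * (f x - (η p.1 + const X p.2) x)) / γ n ∂θ < M := fun n => by
      obtain ⟨_, ⟨_, ⟨A, a, rfl⟩, rfl⟩, hlt⟩ := exists_lt_of_csInf_lt
        (by exact ⟨_, η A₁ + const X 0, hmem _ _, rfl⟩)
        ((not_lt.1 (hγ n).1).trans_lt hmM)
      exact ⟨(A, a), hlt⟩
    choose p hp using hex
    have hγ0 : ∀ n, 0 < γ n := fun n => zero_lt_one.trans_le (hγ n).2
    have hbound : ∀ {L K : ℝ}, (∀ y, L * max y 0 - K ≤ β y) → ∀ n,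
        (∫ x, (η (p n).1 + const X (p n).2) x ∂μ0)
          + L * (∫ x, max (f x - (η (p n).1 + const X (p n).2) x) 0 ∂θ) ≤ M + K / γ n :=
      fun hK n => by
        have := mul_integral_posPart_sub_le θ hβ0 hβ hβmono (hγ0 n) hK f
          (η (p n).1 + const X (p n).2)
        linarith [hp n]
    have hmemK : ∀ n, p n ∈ (Set.univ : Set 𝒜) ×ˢ
        Set.Icc (-2 * ‖f‖ - 3 * C - M - |K₂|) (M + C) := fun n => by
      have h1 := (integral_shift_mem_Icc (μ := μ0) (hbd (p n).1) (p n).2).1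
      have h2 := hbound (L := 0) (K := 0) (fun y => by simpa using hβ0 y) n
      have h3 := hbound hK₂ n
      have h4 := sub_le_integral_posPart_sub_shift (θ := θ) (hbd (p n).1) f (p n).2
      have h5 : K₂ / γ n ≤ |K₂| := (div_le_div_of_nonneg_right (le_abs_self K₂) (hγ0 n).le).trans
        (div_le_self (abs_nonneg _) (hγ n).2)
      rw [zero_mul, zero_div] at h2
      exact ⟨trivial, by linarith, by linarith⟩
    obtain ⟨q, -, φ, hφ, hq⟩ := (isCompact_univ.prod isCompact_Icc).tendsto_subseq hmemK
    have hlim : ∀ L : ℝ, 0 ≤ L → (∫ x, (η q.1 + const X q.2) x ∂μ0)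
        + L * (∫ x, max (f x - (η q.1 + const X q.2) x) 0 ∂θ) ≤ M := fun L hL => by
      obtain ⟨K, hK⟩ := exists_mul_posPart_sub_le hβ0 hβsl hL
      have h1 := ((continuous_integral_shift μ0 hcont0).tendsto q).comp hq
      have h2 := ((continuous_integral_posPart_sub_shift θ hcontθ f).tendsto q).comp hq
      have h3 : Tendsto (fun n => M + K / γ (φ n)) atTop (𝓝 (M + 0)) :=
        tendsto_const_nhds.add ((hγlim.comp hφ.tendsto_atTop).const_div_atTop K)
      rw [add_zero] at h3
      exact le_of_tendsto_of_tendsto' (h1.add (h2.const_mul L)) h3 fun n => hbound hK (φ n)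
    have hle : ∀ x, f x ≤ (η q.1 + const X q.2) x := by
      refine le_of_integral_posPart_sub_nonpos hθpos (not_lt.1 fun hpos => ?_)
      obtain ⟨n, hn⟩ := exists_nat_gt
        ((M - ∫ x, (η q.1 + const X q.2) x ∂μ0)
          / ∫ x, max (f x - (η q.1 + const X q.2) x) 0 ∂θ)
      rw [div_lt_iff₀ hpos] at hn
      linarith [hlim n n.cast_nonneg]
    have := hlim 0 le_rfl
    rw [zero_mul, add_zero] at this
    linarith [hphi _ (hmem q.1 q.2) hle]
  · have hlim : Tendsto (fun γ : ℝ => phi μ0 H f + β 0 / γ) atTop (𝓝 (phi μ0 H f + 0)) :=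
      tendsto_const_nhds.add (tendsto_id.const_div_atTop (β 0))
    rw [add_zero] at hlim
    filter_upwards [hlim.eventually_lt_const hm, eventually_gt_atTop 0] with γ h1 h2
    exact (hupper γ h2).trans_lt h1
end
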